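/- arXiv:1507.01104 — 2 statements merged into one kernel-verified Lean document; each statement's English description precedes it below -/
import Mathlib

section
/- Let ν > -1. For every real x with |x| < γ_{ν,1} one has x·𝒲_ν'(x)/𝒲_ν(x) = -4·∑_{m≥1} ζ_{4m}(ν)·x^{4m}. Moreover the function x ↦ -x·𝒲_ν'(x)/𝒲_ν(x) is absolutely monotonic on (0, γ_{ν,1}). -/
open Real Set

/-- Bessel function of the first kind `J_ν(x)` (series definition, intended for `x > 0`). -/
noncomputable def besselJ (ν x : ℝ) : ℝ :=
  ∑' n : ℕ, (-1 : ℝ) ^ n * (x / 2) ^ (ν + 2 * (n : ℝ)) /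
    ((n.factorial : ℝ) * Real.Gamma (ν + n + 1))

/-- Modified Bessel function of the first kind `I_ν(x)` (series definition, for `x > 0`). -/
noncomputable def besselI (ν x : ℝ) : ℝ :=
  ∑' n : ℕ, (x / 2) ^ (ν + 2 * (n : ℝ)) /
    ((n.factorial : ℝ) * Real.Gamma (ν + n + 1))

/-- The cross-product `W_ν(x) = J_{ν+1}(x) I_ν(x) + J_ν(x) I_{ν+1}(x)`. -/
noncomputable def crossW (ν x : ℝ) : ℝ :=
  besselJ (ν + 1) x * besselI ν x + besselJ ν x * besselI (ν + 1) x

/-- The normalized cross-product `𝒲_ν`, an even entire function of `x`. -/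
noncomputable def Wcal (ν x : ℝ) : ℝ :=
  ∑' n : ℕ, (-1 : ℝ) ^ n * (Real.Gamma (ν + 1) * Real.Gamma (ν + 2)) * x ^ (4 * n) /
    ((2 : ℝ) ^ (4 * n) * (n.factorial : ℝ) * Real.Gamma (ν + n + 1) * Real.Gamma (ν + 2 * n + 2))

/-- The normalized Dini function `𝒟_ν`. -/
noncomputable def Dcal (ν x : ℝ) : ℝ :=
  ∑' n : ℕ, (-1 : ℝ) ^ n * (2 * (n : ℝ) + 1) * Real.Gamma (ν + 1) * x ^ (2 * n) /
    ((2 : ℝ) ^ (2 * n) * (n.factorial : ℝ) * Real.Gamma (ν + n + 1))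

/-- The normalized modified Dini function `λ_ν`. -/
noncomputable def lamDini (ν x : ℝ) : ℝ :=
  ∑' n : ℕ, (2 * (n : ℝ) + 1) * Real.Gamma (ν + 1) * x ^ (2 * n) /
    ((2 : ℝ) ^ (2 * n) * (n.factorial : ℝ) * Real.Gamma (ν + n + 1))

/-- The normalized Bessel function `𝒥_ν`. -/
noncomputable def Jcal (ν x : ℝ) : ℝ :=
  ∑' n : ℕ, (-1 : ℝ) ^ n * Real.Gamma (ν + 1) * x ^ (2 * n) /
    ((2 : ℝ) ^ (2 * n) * (n.factorial : ℝ) * Real.Gamma (ν + n + 1))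

/-- The normalized modified Bessel function `𝓘_ν`. -/
noncomputable def Ical (ν x : ℝ) : ℝ :=
  ∑' n : ℕ, Real.Gamma (ν + 1) * x ^ (2 * n) /
    ((2 : ℝ) ^ (2 * n) * (n.factorial : ℝ) * Real.Gamma (ν + n + 1))

/-- A function is absolutely monotonic on a set if it is infinitely differentiable there and
all of its (iterated) derivatives are nonnegative there. -/
def AbsolutelyMonotonicOn (f : ℝ → ℝ) (s : Set ℝ) : Prop :=
  ContDiffOn ℝ (⊤ : ℕ∞) f s ∧ ∀ (k : ℕ), ∀ x ∈ s, 0 ≤ iteratedDerivWithin k f s x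

open Polynomial in
noncomputable def ThOp (c : ℝ) (p : ℝ[X]) : ℝ[X] := C c * p + X * derivative p

open Polynomial in
lemma ThOp_coeff (c : ℝ) (p : ℝ[X]) (n : ℕ) : (ThOp c p).coeff n = (c + n) * p.coeff n := by
  unfold ThOp
  cases n with
  | zero => simp
  | succ n =>
    simp [coeff_X_mul, coeff_derivative]
    ring

open Polynomial in
def PosRooted (p : ℝ[X]) : Prop := p ≠ 0 ∧ p.Splits ∧ ∀ r ∈ p.roots, 0 < r

open Polynomial in
lemma ThOp_posRooted {c : ℝ} (hc : 0 < c) {p : ℝ[X]} (hp : PosRooted p) : PosRooted (ThOp c p) := by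
  obtain ⟨h0, hs, hr⟩ := hp
  have hp0 : p.coeff 0 ≠ 0 := by
    intro h
    have : (0:ℝ) ∈ p.roots := by
      rw [mem_roots h0]; simpa [IsRoot, coeff_zero_eq_eval_zero] using h
    exact lt_irrefl _ (hr 0 this)
  have hT0 : ThOp c p ≠ 0 := by
    intro h
    have := ThOp_coeff c p 0
    rw [h] at this
    simp at this
    rcases this with h | h
    · exact hc.ne' h
    · exact hp0 h
  have key : ∀ z : ℂ, ((ThOp c p).map Complex.ofRealHom).eval z = 0 → z.im = 0 ∧ 0 < z.re := by
    intro z hz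
    have hsC := hs.map Complex.ofRealHom
    have hroots := hs.roots_map Complex.ofRealHom
    by_cases hpz : (p.map Complex.ofRealHom).eval z = 0
    · have : z ∈ (p.map Complex.ofRealHom).roots := by
        rw [mem_roots (Polynomial.map_ne_zero h0)]; exact hpz
      rw [hroots, Multiset.mem_map] at this
      obtain ⟨r, hrm, rfl⟩ := this
      exact ⟨by simp, by simpa using hr r hrm⟩
    · have hder := hsC.eval_derivative_eq_eval_mul_sum hpz
      have e1 : ((ThOp c p).map Complex.ofRealHom).eval z =
          (p.map Complex.ofRealHom).eval z *
            (c + (p.roots.map fun r : ℝ => z / (z - r)).sum) := by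
        have : (p.roots.map fun r : ℝ => z / (z - r)).sum =
            z * ((p.map Complex.ofRealHom).roots.map fun w => 1 / (z - w)).sum := by
          rw [hroots, Multiset.map_map, ← Multiset.sum_map_mul_left]
          congr 1
          apply Multiset.map_congr rfl
          intro r _
          simp [div_eq_mul_inv]
        rw [this]
        simp only [ThOp, Polynomial.map_add, Polynomial.map_mul, map_C, map_X, eval_add, eval_mul,
          eval_C, eval_X, ← derivative_map]
        rw [hder]
        simp only [Complex.ofRealHom_eq_coe]
        ring
      rw [e1] at hz
      have hz2 := (mul_eq_zero.mp hz).resolve_left hpz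
      have hne : ∀ r ∈ p.roots, z - (r:ℂ) ≠ 0 := by
        intro r hrm h
        apply hpz
        have hzr : z = r := sub_eq_zero.mp h
        have : z ∈ (p.map Complex.ofRealHom).roots := by
          rw [hroots, Multiset.mem_map]; exact ⟨r, hrm, by simp [hzr]⟩
        exact (mem_roots (Polynomial.map_ne_zero h0)).mp this
      have him : (p.roots.map fun r : ℝ => (-r * z.im) / Complex.normSq (z - r)).sum = 0 := by
        have := congrArg Complex.imAddGroupHom hz2
        rw [map_add, map_multiset_sum, Multiset.map_map] at this
        simp only [Complex.imAddGroupHom, AddMonoidHom.coe_mk, ZeroHom.coe_mk, Complex.ofReal_im,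
          zero_add, Complex.zero_im] at this
        rw [← this]
        congr 1
        apply Multiset.map_congr rfl
        intro r _
        simp [Complex.div_im]
        ring
      have hre : c + (p.roots.map fun r : ℝ => (z.re * (z.re - r) + z.im * z.im) / Complex.normSq (z - r)).sum = 0 := by
        have := congrArg Complex.reAddGroupHom hz2
        rw [map_add, map_multiset_sum, Multiset.map_map] at this
        simp only [Complex.reAddGroupHom, AddMonoidHom.coe_mk, ZeroHom.coe_mk, Complex.ofReal_re,
          Complex.zero_re] at this
        rw [← this]
        congr 2
        apply Multiset.map_congr rfl
        intro r _
        simp [Complex.div_re]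
        ring
      have him0 : z.im = 0 := by
        by_contra hi
        have h1 : z.im * (p.roots.map fun r : ℝ => r / Complex.normSq (z - r)).sum = 0 := by
          rw [← Multiset.sum_map_mul_left, ← neg_eq_zero, ← him, ← Multiset.sum_map_neg',
            Multiset.map_map]
          congr 1
          apply Multiset.map_congr rfl
          intro r _
          simp only [Function.comp]
          ring
        have h2 := (mul_eq_zero.mp h1).resolve_left hi
        have h3 : p.roots = 0 := by
          by_contra hne0
          obtain ⟨r, hrm⟩ := Multiset.exists_mem_of_ne_zero hne0
          have hp1 : ∀ r ∈ p.roots, 0 < r / Complex.normSq (z - r) := fun r hrm =>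
            div_pos (hr r hrm) (Complex.normSq_pos.mpr (hne r hrm))
          have h5 : r / Complex.normSq (z - r) ≤
              (p.roots.map fun r : ℝ => r / Complex.normSq (z - r)).sum := by
            apply Multiset.single_le_sum
            · intro x hx
              obtain ⟨r, hrm, rfl⟩ := Multiset.mem_map.mp hx
              exact (hp1 r hrm).le
            · exact Multiset.mem_map_of_mem _ hrm
          have := hp1 r hrm
          linarith
        rw [h3] at hre
        simp at hre
        linarith
      refine ⟨him0, ?_⟩
      by_contra hneg
      push Not at hneg
      have : 0 ≤ (p.roots.map fun r : ℝ => (z.re * (z.re - r) + z.im * z.im) / Complex.normSq (z - r)).sum := by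
        apply Multiset.sum_nonneg
        intro x hx
        obtain ⟨r, hrm, rfl⟩ := Multiset.mem_map.mp hx
        apply div_nonneg _ (Complex.normSq_nonneg _)
        have := hr r hrm
        nlinarith [mul_nonneg_of_nonpos_of_nonpos hneg (by linarith : z.re - r ≤ 0)]
      linarith
  refine ⟨hT0, ?_, ?_⟩
  · apply Splits.of_splits_map Complex.ofRealHom (IsAlgClosed.splits _)
    intro w hw
    rw [mem_roots (Polynomial.map_ne_zero hT0)] at hw
    refine ⟨w.re, ?_⟩
    apply Complex.ext <;> simp [(key w hw).1]
  · intro r hrm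
    rw [mem_roots hT0] at hrm
    have := key r (by rw [show (r:ℂ) = Complex.ofRealHom r from rfl, eval_map_apply, hrm.eq_zero]; simp)
    simpa using this.2

open Polynomial in
lemma posRooted_factor {p : ℝ[X]} (hp : PosRooted p) : ∃ (N : ℕ) (s : ℕ → ℝ), Antitone s ∧
    (∀ j, 0 ≤ s j) ∧ (∀ j, N ≤ j → s j = 0) ∧
    p = C (p.coeff 0) * ∏ j ∈ Finset.range N, (1 - C (s j) * X) := by
  obtain ⟨h0, hs, hr⟩ := hp
  set l := (p.roots.map (fun r => r⁻¹)).sort (· ≥ ·) with hl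
  have hlp : ∀ x ∈ l, 0 < x := by
    intro x hx
    rw [hl, Multiset.mem_sort, Multiset.mem_map] at hx
    obtain ⟨r, hrm, rfl⟩ := hx
    exact inv_pos.mpr (hr r hrm)
  have hsorted : l.Pairwise (· ≥ ·) := Multiset.pairwise_sort _ _
  have hnn : ∀ j, 0 ≤ l.getD j 0 := by
    intro j
    by_cases hj : j < l.length
    · rw [List.getD_eq_getElem _ _ hj]; exact (hlp _ (List.getElem_mem hj)).le
    · rw [List.getD_eq_default _ _ (by omega)]
  refine ⟨l.length, fun j => l.getD j 0, ?_, hnn, ?_, ?_⟩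
  · intro i j hij
    show l.getD j 0 ≤ l.getD i 0
    by_cases hj : j < l.length
    · rw [List.getD_eq_getElem _ _ hj, List.getD_eq_getElem _ _ (lt_of_le_of_lt hij hj)]
      rcases hij.eq_or_lt with rfl | h
      · exact le_rfl
      · exact List.pairwise_iff_getElem.mp hsorted i j _ _ h
    · rw [List.getD_eq_default _ _ (by omega)]; exact hnn i
  · intro j hj
    show l.getD j 0 = 0
    rw [List.getD_eq_default _ _ (by omega)]
  · have h1 : ∏ j ∈ Finset.range l.length, (1 - C (l.getD j 0) * X : ℝ[X])
        = (p.roots.map (fun r => (1 - C r⁻¹ * X : ℝ[X]))).prod := by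
      have : (p.roots.map (fun r => (1 - C r⁻¹ * X : ℝ[X]))) =
         ((p.roots.map (fun r => r⁻¹)).map (fun r => (1 - C r * X : ℝ[X]))) := by
        rw [Multiset.map_map]; rfl
      rw [this, ← Multiset.sort_eq (p.roots.map (fun r => r⁻¹)) (· ≥ ·), ← hl, Multiset.map_coe,
        Multiset.prod_coe, Finset.prod_range, ← List.prod_ofFn]
      congr 1
      apply List.ext_getElem
      · simp
      · intro i h1 h2
        simp at h1
        simp
    rw [h1]
    have h2 : (p.roots.map (fun r => (X - C r : ℝ[X]))).prod =
       C ((p.roots.map (fun r => -r)).prod) * (p.roots.map (fun r => (1 - C r⁻¹ * X : ℝ[X]))).prod := by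
      rw [map_multiset_prod, Multiset.map_map, ← Multiset.prod_map_mul]
      congr 1
      apply Multiset.map_congr rfl
      intro r hrm
      have := (hr r hrm).ne'
      have e : C r * C r⁻¹ = (1:ℝ[X]) := by rw [← C_mul, mul_inv_cancel₀ this, C_1]
      simp only [Function.comp, C_neg]
      linear_combination (-X) * e
    have h3 := hs.eq_prod_roots
    rw [h2, ← mul_assoc, ← C_mul] at h3
    have h4 : p.coeff 0 = p.leadingCoeff * (p.roots.map (fun r => -r)).prod := by
      conv_lhs => rw [h3]
      rw [coeff_C_mul, coeff_zero_eq_eval_zero, eval_multiset_prod, Multiset.map_map]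
      simp
    rw [h4]; exact h3


noncomputable def poch (a : ℝ) (n : ℕ) : ℝ := ∏ k ∈ Finset.range n, (a + k)

lemma poch_zero (a : ℝ) : poch a 0 = 1 := by simp [poch]

lemma poch_succ (a : ℝ) (n : ℕ) : poch a (n + 1) = poch a n * (a + n) := by
  simp [poch, Finset.prod_range_succ]

lemma poch_add (a : ℝ) (n m : ℕ) : poch a (n + m) = poch a n * poch (a + n) m := by
  simp only [poch, Finset.prod_range_add]
  congr 1
  apply Finset.prod_congr rfl
  intro k _
  push_cast; ring

lemma poch_pos {a : ℝ} (ha : 0 < a) (n : ℕ) : 0 < poch a n :=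
  Finset.prod_pos fun k _ => by positivity

lemma pow_le_poch {a : ℝ} (ha : 0 < a) (n : ℕ) : a ^ n ≤ poch a n := by
  induction n with
  | zero => simp [poch]
  | succ n ih =>
    rw [poch_succ, pow_succ]
    apply mul_le_mul ih _ ha.le (poch_pos ha n).le
    have : (0:ℝ) ≤ n := n.cast_nonneg
    linarith

lemma factorial_le_poch {a : ℝ} (ha : 1 ≤ a) (n : ℕ) : (n.factorial : ℝ) ≤ poch a n := by
  induction n with
  | zero => simp [poch]
  | succ n ih =>
    rw [poch_succ, Nat.factorial_succ, mul_comm]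
    push_cast
    apply mul_le_mul ih _ (by positivity) (poch_pos (by linarith) n).le
    linarith

lemma poch_swap {a : ℝ} (ha : 0 < a) (n K : ℕ) :
    poch (a + n) K / poch a K = poch (a + K) n / poch a n := by
  rw [div_eq_div_iff (poch_pos ha K).ne' (poch_pos ha n).ne', mul_comm, ← poch_add, mul_comm,
    ← poch_add, add_comm]

lemma poch_shift_tendsto (a : ℝ) (n : ℕ) :
    Filter.Tendsto (fun M : ℕ => poch (a + M) n / (M:ℝ) ^ n) Filter.atTop (nhds 1) := by
  induction n with
  | zero => simp [poch]
  | succ n ih =>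
    have h1 : Filter.Tendsto (fun M : ℕ => (a + M + n) / (M:ℝ)) Filter.atTop (nhds 1) := by
      have : Filter.Tendsto (fun M : ℕ => 1 + (a + n) / (M:ℝ)) Filter.atTop (nhds (1 + 0)) :=
        tendsto_const_nhds.add (tendsto_const_div_atTop_nhds_zero_nat _)
      rw [add_zero] at this
      refine this.congr' ?_
      filter_upwards [Filter.eventually_gt_atTop 0] with M hM
      have : (M:ℝ) ≠ 0 := by positivity
      field_simp; ring
    have := ih.mul h1
    rw [mul_one] at this
    refine this.congr fun M => ?_
    rw [poch_succ, pow_succ, div_mul_div_comm]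

lemma poch_shift_le {a : ℝ} (ha : 0 < a) {n M : ℕ} (hM : 1 ≤ M) (hn : n ≤ 2 * M) :
    poch (a + M) n / (M:ℝ) ^ n ≤ (a + 3) ^ n := by
  have hMr : (1:ℝ) ≤ M := by exact_mod_cast hM
  induction n with
  | zero => simp [poch]
  | succ n ih =>
    rw [poch_succ, pow_succ, mul_div_mul_comm, pow_succ]
    apply mul_le_mul (ih (by omega)) _ (by positivity) (by positivity)
    rw [div_le_iff₀ (by linarith)]
    have : (n:ℝ) ≤ 2 * M := by exact_mod_cast (by omega : n ≤ 2 * M)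
    nlinarith

lemma choose_tendsto (n : ℕ) :
    Filter.Tendsto (fun M : ℕ => (M.choose n : ℝ) / (M:ℝ) ^ n) Filter.atTop
      (nhds (1 / n.factorial)) := by
  have h : Filter.Tendsto (fun M : ℕ => (M.descFactorial n : ℝ) / (M:ℝ) ^ n) Filter.atTop
      (nhds 1) := by
    induction n with
    | zero => simp
    | succ n ih =>
      have h1 : Filter.Tendsto (fun M : ℕ => ((M - n : ℕ):ℝ) / (M:ℝ)) Filter.atTop (nhds 1) := by
        have : Filter.Tendsto (fun M : ℕ => 1 - (n:ℝ) / (M:ℝ)) Filter.atTop (nhds (1 - 0)) :=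
          tendsto_const_nhds.sub (tendsto_const_div_atTop_nhds_zero_nat _)
        rw [sub_zero] at this
        refine this.congr' ?_
        filter_upwards [Filter.eventually_gt_atTop n] with M hM
        have : (M:ℝ) ≠ 0 := by exact_mod_cast (by omega : M ≠ 0)
        rw [Nat.cast_sub hM.le]
        field_simp
      have := h1.mul ih
      rw [mul_one] at this
      refine this.congr fun M => ?_
      rw [Nat.descFactorial_succ, pow_succ]
      push_cast
      rw [div_mul_div_comm, mul_comm ((M:ℝ)^n)]
  refine (h.div_const (n.factorial : ℝ)).congr fun M => ?_
  rw [Nat.descFactorial_eq_factorial_mul_choose]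
  push_cast
  have : (n.factorial : ℝ) ≠ 0 := by positivity
  field_simp

noncomputable def fc (a b : ℝ) (n : ℕ) : ℝ :=
  (-1) ^ n / (n.factorial * poch a n * poch b (2 * n))

noncomputable def gc (a b : ℝ) (M n : ℕ) : ℝ :=
  (-1) ^ n * ((M.choose n : ℝ) / (M:ℝ) ^ n) * (poch (a + M) n / (M:ℝ) ^ n) / poch a n *
    (poch (b + M) (2 * n) / (M:ℝ) ^ (2 * n)) / poch b (2 * n)

lemma gc_tendsto {a b : ℝ} (n : ℕ) :
    Filter.Tendsto (fun M => gc a b M n) Filter.atTop (nhds (fc a b n)) := by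
  have := (((((choose_tendsto n).const_mul ((-1)^n)).mul (poch_shift_tendsto a n)).div_const
    (poch a n)).mul (poch_shift_tendsto b (2 * n))).div_const (poch b (2*n))
  have e : fc a b n = (-1) ^ n * (1 / (n.factorial : ℝ)) * 1 / poch a n * 1 / poch b (2 * n) := by
    simp only [fc, mul_one, div_eq_mul_inv, mul_inv, one_mul]
    ring
  rw [e]
  exact this

noncomputable def BB (a b : ℝ) : ℝ := (a + 3) / a * ((b + 3) / b) ^ 2

lemma gc_bound {a b : ℝ} (ha : 0 < a) (hb : 0 < b) {M : ℕ} (hM : 1 ≤ M) (n : ℕ) :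
    |gc a b M n| ≤ BB a b ^ n / n.factorial := by
  have hMr : (1:ℝ) ≤ M := by exact_mod_cast hM
  by_cases hn : n ≤ M
  · have h1 : (M.choose n : ℝ) / (M:ℝ) ^ n ≤ 1 / n.factorial := by
      rw [div_le_div_iff₀ (by positivity) (by positivity)]
      have := Nat.choose_le_pow_div (α := ℝ) n M
      rw [le_div_iff₀ (by positivity)] at this
      linarith
    have h2 := poch_shift_le ha hM (by omega : n ≤ 2 * M)
    have h3 := poch_shift_le hb hM (by omega : 2 * n ≤ 2 * M)
    have p1 := poch_pos ha n
    have p2 := poch_pos hb (2 * n)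
    have p3 : 0 < poch (a + M) n := poch_pos (by positivity) n
    have p4 : 0 < poch (b + M) (2*n) := poch_pos (by positivity) _
    have h4 := pow_le_poch ha n
    have h5 := pow_le_poch hb (2 * n)
    have : |gc a b M n| = ((M.choose n : ℝ) / (M:ℝ) ^ n) * (poch (a + M) n / (M:ℝ) ^ n) / poch a n *
    (poch (b + M) (2 * n) / (M:ℝ) ^ (2 * n)) / poch b (2 * n) := by
      unfold gc
      rw [abs_div, abs_mul, abs_div, abs_mul, abs_mul, abs_pow, abs_neg, abs_one, one_pow, one_mul,
        abs_of_pos p1, abs_of_pos p2, abs_of_nonneg (by positivity : 0 ≤ (M.choose n : ℝ) / (M:ℝ) ^ n),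
        abs_of_pos (by positivity : 0 < (poch (a + M) n / (M:ℝ) ^ n)), abs_of_pos (by positivity : 0 < (poch (b + M) (2 * n) / (M:ℝ) ^ (2 * n)))]
    rw [this]
    calc _ ≤ (1 / n.factorial) * ((a + 3) ^ n) / a ^ n * (b + 3) ^ (2 * n) / b ^ (2 * n) := by
          gcongr
      _ = _ := by
          unfold BB
          rw [mul_pow, div_pow, ← pow_mul, div_pow]
          field_simp
  · have : gc a b M n = 0 := by
      unfold gc
      rw [Nat.choose_eq_zero_of_lt (by omega)]
      simp
    rw [this, abs_zero]
    unfold BB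
    positivity

lemma fc_bound {a b : ℝ} (ha : 0 < a) (hb : 0 < b) (n : ℕ) :
    |fc a b n| ≤ BB a b ^ n / n.factorial := by
  refine le_of_tendsto (gc_tendsto n).abs ?_
  filter_upwards [Filter.eventually_ge_atTop 1] with M hM
  exact gc_bound ha hb hM n

open Polynomial in
noncomputable def SP (a b : ℝ) (M : ℕ) : ℕ → ℝ[X]
  | 0 => (1 - X) ^ M
  | K + 1 => ThOp (a + K) (ThOp ((b + K) / 2) (SP a b M K))

open Polynomial in
lemma SP_coeff (a b : ℝ) (M K n : ℕ) : (SP a b M K).coeff n =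
    poch (a + n) K * poch (b + 2 * n) K / 2 ^ K * ((-1) ^ n * M.choose n) := by
  induction K with
  | zero =>
    simp only [SP, poch_zero]
    have : (1 - X : ℝ[X]) ^ M = ((1 + X) ^ M).comp (C (-1) * X) := by simp [sub_eq_add_neg]
    rw [this, comp_C_mul_X_coeff, coeff_one_add_X_pow]
    simp; ring
  | succ K ih =>
    simp only [SP, ThOp_coeff, ih, poch_succ, pow_succ]
    field_simp
    ring

open Polynomial in
lemma SP_posRooted {a b : ℝ} (ha : 0 < a) (hb : 0 < b) (M K : ℕ) : PosRooted (SP a b M K) := by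
  induction K with
  | zero =>
    have e : (1 - X : ℝ[X]) = -(X - C 1) := by simp
    have h0 : (1 - X : ℝ[X]) ≠ 0 := by rw [e]; exact neg_ne_zero.mpr (X_sub_C_ne_zero 1)
    refine ⟨pow_ne_zero _ h0, ?_, ?_⟩
    · exact Splits.pow (by rw [e]; exact (Splits.X_sub_C 1).neg) _
    · intro r hr
      simp only [SP] at hr
      rw [mem_roots (pow_ne_zero _ h0)] at hr
      simp only [IsRoot, eval_pow, eval_sub, eval_one, eval_X] at hr
      have := eq_zero_of_pow_eq_zero hr
      linarith
  | succ K ih =>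
    exact ThOp_posRooted (by positivity) (ThOp_posRooted (by positivity) ih)

open Polynomial in
lemma approx {a b : ℝ} (ha : 0 < a) (hb : 0 < b) {M : ℕ} (hM : 1 ≤ M) :
    ∃ p : ℝ[X], (∀ n, p.coeff n = gc a b M n) ∧ ∃ (N : ℕ) (s : ℕ → ℝ), Antitone s ∧
    (∀ j, 0 ≤ s j) ∧ (∀ j, N ≤ j → s j = 0) ∧
    p = ∏ j ∈ Finset.range N, (1 - C (s j) * X) := by
  have hMr : (1:ℝ) ≤ M := by exact_mod_cast hM
  obtain ⟨N, s, h1, h2, h3, h4⟩ := posRooted_factor (SP_posRooted ha hb M M)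
  have hc0 : (SP a b M M).coeff 0 ≠ 0 := by
    rw [SP_coeff]
    have := poch_pos ha M
    have := poch_pos hb M
    simp; constructor <;> positivity
  refine ⟨C ((SP a b M M).coeff 0)⁻¹ * (SP a b M M).comp (C (((M:ℝ)^4)⁻¹) * X), ?_,
    N, fun j => s j * ((M:ℝ)^4)⁻¹, ?_, ?_, ?_, ?_⟩
  · intro n
    rw [coeff_C_mul, comp_C_mul_X_coeff, SP_coeff, SP_coeff]
    have e1 := poch_swap ha n M
    have e2 := poch_swap hb (2 * n) M
    have q1 := (poch_pos ha M).ne'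
    have q2 := (poch_pos hb M).ne'
    have q3 := (poch_pos ha n).ne'
    have q4 := (poch_pos hb (2*n)).ne'
    have q5 : (M:ℝ) ≠ 0 := by positivity
    push_cast at e2
    rw [div_eq_iff q1] at e1
    rw [div_eq_iff q2] at e2
    rw [e1, e2]
    simp only [gc, Nat.cast_zero, mul_zero, add_zero, pow_zero, Nat.choose_zero_right, Nat.cast_one, mul_one]
    have q6 : (((M:ℝ) ^ 4)⁻¹) ^ n = ((M:ℝ) ^ n)⁻¹ * ((M:ℝ) ^ n)⁻¹ * ((M:ℝ) ^ (2 * n))⁻¹ := by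
      rw [inv_pow, ← pow_mul, ← mul_inv, ← mul_inv, ← pow_add, ← pow_add]
      congr 2; ring
    rw [q6]
    field_simp
  · intro i j hij
    exact mul_le_mul_of_nonneg_right (h1 hij) (by positivity)
  · intro j; have := h2 j; positivity
  · intro j hj; simp [h3 j hj]
  · conv_lhs => 
      arg 2
      rw [h4]
    rw [mul_comp, C_comp, prod_comp, ← mul_assoc, ← C_mul, inv_mul_cancel₀ hc0, C_1, one_mul]
    apply Finset.prod_congr rfl
    intro j _
    simp
    ring


noncomputable def EE (a b : ℝ) (i : ℕ) (u : ℝ) : ℝ := ∑' n : ℕ, fc a b n * (n:ℝ) ^ i * u ^ n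

lemma term_bound {c B : ℝ} (n i : ℕ) (u : ℝ) (hB : 0 ≤ B) (h : |c| ≤ B ^ n / n.factorial) :
    ‖c * (n:ℝ) ^ i * u ^ n‖ ≤ (B * 2 ^ i * |u|) ^ n / n.factorial := by
  rw [Real.norm_eq_abs, abs_mul, abs_mul, abs_pow, abs_pow, Nat.abs_cast]
  have h2 : (n:ℝ) ^ i ≤ (2 ^ i) ^ n := by
    rw [← pow_mul, mul_comm, pow_mul]
    apply pow_le_pow_left₀ (by positivity)
    exact_mod_cast (Nat.lt_two_pow_self).le
  calc _ ≤ (B ^ n / n.factorial) * (2 ^ i) ^ n * |u| ^ n := by gcongr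
    _ = _ := by rw [mul_pow, mul_pow]; ring

lemma BB_nonneg {a b : ℝ} (ha : 0 < a) (hb : 0 < b) : 0 ≤ BB a b := by unfold BB; positivity

lemma EE_summable {a b : ℝ} (ha : 0 < a) (hb : 0 < b) (i : ℕ) (u : ℝ) :
    Summable (fun n : ℕ => fc a b n * (n:ℝ) ^ i * u ^ n) :=
  Summable.of_norm_bounded (Real.summable_pow_div_factorial _)
    (fun n => term_bound n i u (BB_nonneg ha hb) (fc_bound ha hb n))

lemma gc_sum_tendsto {a b : ℝ} (ha : 0 < a) (hb : 0 < b) (i : ℕ) (u : ℝ) :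
    Filter.Tendsto (fun M => ∑' n : ℕ, gc a b M n * (n:ℝ) ^ i * u ^ n) Filter.atTop
      (nhds (EE a b i u)) := by
  apply tendsto_tsum_of_dominated_convergence
    (bound := fun n : ℕ => (BB a b * 2 ^ i * |u|) ^ n / n.factorial)
    (Real.summable_pow_div_factorial _)
  · intro n
    exact ((gc_tendsto n).mul_const _).mul_const _
  · filter_upwards [Filter.eventually_ge_atTop 1] with M hM n
    exact term_bound n i u (BB_nonneg ha hb) (gc_bound ha hb hM n)

open Polynomial in
lemma eval_tsum (p : ℝ[X]) (u : ℝ) : p.eval u = ∑' n : ℕ, p.coeff n * u ^ n := by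
  rw [eval_eq_sum_range, tsum_eq_sum]
  intro n hn
  rw [coeff_eq_zero_of_natDegree_lt (by simpa using hn), zero_mul]

open Polynomial in
lemma eval_gc {a b : ℝ} {M : ℕ} {p : ℝ[X]} (hp : ∀ n, p.coeff n = gc a b M n) (u : ℝ) :
    ∑' n : ℕ, gc a b M n * (n:ℝ) ^ 0 * u ^ n = p.eval u := by
  rw [eval_tsum]; simp [hp]

open Polynomial in
lemma eval_gc1 {a b : ℝ} {M : ℕ} {p : ℝ[X]} (hp : ∀ n, p.coeff n = gc a b M n) (u : ℝ) :
    ∑' n : ℕ, gc a b M n * (n:ℝ) ^ 1 * u ^ n = u * p.derivative.eval u := by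
  have : u * p.derivative.eval u = (ThOp 0 p).eval u := by simp [ThOp]
  rw [this, eval_tsum]
  congr 1; ext n
  rw [ThOp_coeff, hp]; ring

open Polynomial in
lemma eval_gc2 {a b : ℝ} {M : ℕ} {p : ℝ[X]} (hp : ∀ n, p.coeff n = gc a b M n) (u : ℝ) :
    ∑' n : ℕ, gc a b M n * (n:ℝ) ^ 2 * u ^ n =
      u * p.derivative.eval u + u ^ 2 * p.derivative.derivative.eval u := by
  have : u * p.derivative.eval u + u ^ 2 * p.derivative.derivative.eval u =
      (ThOp 0 (ThOp 0 p)).eval u := by simp [ThOp]; ring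
  rw [this, eval_tsum]
  congr 1; ext n
  rw [ThOp_coeff, ThOp_coeff, hp]; ring

open Polynomial in
lemma laguerre_poly (N : ℕ) (s : ℕ → ℝ) (u : ℝ) :
    (∏ j ∈ Finset.range N, (1 - C (s j) * X)).eval u *
      (derivative (derivative (∏ j ∈ Finset.range N, (1 - C (s j) * X)))).eval u ≤
    ((derivative (∏ j ∈ Finset.range N, (1 - C (s j) * X))).eval u) ^ 2 := by
  induction N with
  | zero => simp
  | succ N ih =>
    rw [Finset.prod_range_succ]
    set q := ∏ j ∈ Finset.range N, (1 - C (s j) * X)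
    simp only [derivative_mul, derivative_sub, derivative_one, derivative_C, derivative_X,
      derivative_add, eval_mul, eval_add, eval_sub, eval_one, eval_C, eval_X, zero_mul, zero_sub, mul_one, zero_add, eval_neg, derivative_neg, neg_zero, mul_zero, add_zero]
    nlinarith [mul_le_mul_of_nonneg_left ih (sq_nonneg (1 - s N * u)), sq_nonneg (s N * eval u q)]

lemma laguerre {a b : ℝ} (ha : 0 < a) (hb : 0 < b) (u : ℝ) :
    EE a b 0 u * (EE a b 2 u - EE a b 1 u) ≤ EE a b 1 u ^ 2 := by
  refine le_of_tendsto_of_tendsto ((gc_sum_tendsto ha hb 0 u).mul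
    ((gc_sum_tendsto ha hb 2 u).sub (gc_sum_tendsto ha hb 1 u)))
    ((gc_sum_tendsto ha hb 1 u).pow 2) ?_
  filter_upwards [Filter.eventually_ge_atTop 1] with M hM
  obtain ⟨p, hp, N, s, -, -, -, h⟩ := approx ha hb hM
  rw [eval_gc hp, eval_gc1 hp, eval_gc2 hp, h]
  have := laguerre_poly N s u
  nlinarith [mul_le_mul_of_nonneg_left this (sq_nonneg u)]

lemma fc_rec {a b : ℝ} (ha : 0 < a) (n : ℕ) :
    a * fc a b n = (a + n) * fc (a + 1) b n := by
  have h : (a + n) * poch a n = a * poch (a + 1) n := by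
    have h1 := poch_add a 1 n
    have h2 := poch_succ a n
    have h3 : poch a 1 = a := by simp [poch]
    rw [add_comm 1 n, h3] at h1
    push_cast at h1
    rw [← h1, h2]; ring
  have p1 := (poch_pos ha n).ne'
  have p2 := (poch_pos (by linarith : 0 < a + 1) n).ne'
  unfold fc
  have h4 : (poch a n)⁻¹ * a = (a + n) * (poch (a+1) n)⁻¹ := by
    field_simp; linarith
  rw [div_eq_mul_inv, div_eq_mul_inv, mul_inv, mul_inv, mul_inv, mul_inv]
  linear_combination ((-1) ^ n * ((n.factorial : ℝ)⁻¹ * (poch b (2 * n))⁻¹)) * h4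

lemma EE_rec {a b : ℝ} (ha : 0 < a) (hb : 0 < b) (i : ℕ) (u : ℝ) :
    a * EE a b i u = a * EE (a + 1) b i u + EE (a + 1) b (i + 1) u := by
  have ha' : 0 < a + 1 := by linarith
  unfold EE
  rw [← tsum_mul_left, ← tsum_mul_left, ← Summable.tsum_add ((EE_summable ha' hb i u).mul_left a)
    (EE_summable ha' hb (i+1) u)]
  congr 1; ext n
  have := fc_rec (b := b) ha n
  rw [pow_succ]
  linear_combination ((n:ℝ) ^ i * u ^ n) * this

lemma EE_double_step {a b : ℝ} (ha : 0 < a) (hb : 0 < b) {u : ℝ}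
    (h0 : EE a b 0 u = 0) (h1 : EE a b 1 u = 0) :
    EE (a + 1) b 0 u = 0 ∧ EE (a + 1) b 1 u = 0 := by
  have r0 := EE_rec ha hb 0 u
  have r1 := EE_rec ha hb 1 u
  have L := laguerre (by linarith : 0 < a + 1) hb u
  rw [h0] at r0
  rw [h1] at r1
  norm_num at r0 r1
  set g0 := EE (a+1) b 0 u
  set g1 := EE (a+1) b 1 u
  set g2 := EE (a+1) b 2 u
  have e1 : g1 = -(a * g0) := by linarith
  have e2 : g2 = a ^ 2 * g0 := by rw [e1] at r1; linarith
  have : g0 ^ 2 = 0 := by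
    rw [e1, e2] at L
    have : a * g0 ^ 2 ≤ 0 := by nlinarith
    have h3 : g0 ^ 2 ≤ 0 := by
      by_contra h; push Not at h
      nlinarith [mul_pos ha h]
    exact le_antisymm h3 (sq_nonneg _)
  have g00 : g0 = 0 := by simpa using this
  exact ⟨g00, by rw [e1, g00]; simp⟩

lemma fc_abs {a b : ℝ} (ha : 0 < a) (hb : 0 < b) (n : ℕ) :
    |fc a b n| = 1 / (n.factorial * poch a n * poch b (2 * n)) := by
  have p1 := poch_pos ha n
  have p2 := poch_pos hb (2 * n)
  unfold fc
  rw [abs_div, abs_pow, abs_neg, abs_one, one_pow, abs_of_pos (by positivity)]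

lemma fc_bound2 {a b : ℝ} (ha : 0 < a) (hb : 0 < b) (K n : ℕ) :
    |fc (a + K) b n| ≤ (1 / (a * b ^ 2)) ^ n / n.factorial := by
  have haK : 0 < a + K := by positivity
  rw [fc_abs haK hb]
  have h1 : a ^ n ≤ poch (a + K) n := by
    refine le_trans ?_ (pow_le_poch haK n)
    apply pow_le_pow_left₀ ha.le
    have : (0:ℝ) ≤ K := K.cast_nonneg
    linarith
  have h2 := pow_le_poch hb (2 * n)
  have h3 := poch_pos haK n
  calc _ ≤ 1 / (n.factorial * a ^ n * b ^ (2 * n)) := by gcongr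
    _ = _ := by rw [pow_mul, div_pow, mul_pow, one_pow]; field_simp

lemma EE_shift_tendsto {a b : ℝ} (ha : 0 < a) (hb : 0 < b) (u : ℝ) :
    Filter.Tendsto (fun K : ℕ => EE (a + K) b 0 u) Filter.atTop (nhds 1) := by
  have e : ∑' n : ℕ, (if n = 0 then (1:ℝ) else 0) = 1 := by simp
  rw [← e]
  apply tendsto_tsum_of_dominated_convergence
    (bound := fun n : ℕ => (1 / (a * b ^ 2) * 2 ^ 0 * |u|) ^ n / n.factorial)
    (Real.summable_pow_div_factorial _)
  · intro n
    by_cases hn : n = 0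
    · subst hn; simp [fc, poch]
    · simp only [hn, if_false]
      have : Filter.Tendsto (fun K : ℕ => fc (a + K) b n) Filter.atTop (nhds 0) := by
        rw [tendsto_zero_iff_abs_tendsto_zero]
        have hb2 := poch_pos hb (2 * n)
        have h0 : Filter.Tendsto (fun K : ℕ => (1 / (poch b (2 * n))) / (K : ℝ)) Filter.atTop (nhds 0) :=
          tendsto_const_div_atTop_nhds_zero_nat _
        refine squeeze_zero' (Filter.Eventually.of_forall fun K => abs_nonneg _) ?_ h0
        filter_upwards [Filter.eventually_ge_atTop 1] with K hK
        have hKr : (1:ℝ) ≤ K := by exact_mod_cast hK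
        have haK : 0 < a + K := by positivity
        simp only [Function.comp]
        rw [fc_abs haK hb, div_div]
        have h1 : (K:ℝ) ≤ poch (a + K) n := by
          refine le_trans ?_ (pow_le_poch haK n)
          calc (K:ℝ) ≤ a + K := by linarith
            _ ≤ (a + K) ^ n := le_self_pow₀ (by linarith) hn
        have h2 : (1:ℝ) ≤ n.factorial := by exact_mod_cast n.factorial_pos
        apply one_div_le_one_div_of_le (by positivity)
        have : (K:ℝ) ≤ n.factorial * poch (a + K) n := by nlinarith
        nlinarith
      simpa using this.mul_const (u^n)
  · filter_upwards with K n
    exact term_bound n 0 u (by positivity) (fc_bound2 ha hb K n)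

lemma EE_simple {a b : ℝ} (ha : 0 < a) (hb : 0 < b) {u : ℝ}
    (h0 : EE a b 0 u = 0) (h1 : EE a b 1 u = 0) : False := by
  have h : ∀ K : ℕ, EE (a + K) b 0 u = 0 ∧ EE (a + K) b 1 u = 0 := by
    intro K
    induction K with
    | zero => simpa using ⟨h0, h1⟩
    | succ K ih =>
      have := EE_double_step (by positivity : 0 < a + K) hb ih.1 ih.2
      push_cast
      rwa [← add_assoc]
  have t := EE_shift_tendsto ha hb u
  simp only [(h _).1] at t
  exact zero_ne_one (tendsto_nhds_unique tendsto_const_nhds t)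


open Polynomial in
lemma prod_deriv (N : ℕ) (s : ℕ → ℝ) (u : ℝ) (h : ∀ j, 1 - s j * u ≠ 0) :
    (derivative (∏ j ∈ Finset.range N, (1 - C (s j) * X))).eval u =
      - (∏ j ∈ Finset.range N, (1 - C (s j) * X)).eval u *
        ∑ j ∈ Finset.range N, s j / (1 - s j * u) := by
  induction N with
  | zero => simp
  | succ N ih =>
    rw [Finset.prod_range_succ, Finset.sum_range_succ]
    simp only [derivative_mul, derivative_sub, derivative_one, derivative_C, derivative_X,
      eval_mul, eval_add, eval_sub, eval_one, eval_C, eval_X, zero_mul, zero_sub, mul_one,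
      zero_add, eval_neg, ih]
    have := h N
    set q := eval u (∏ j ∈ Finset.range N, (1 - C (s j) * X))
    set S := ∑ j ∈ Finset.range N, s j / (1 - s j * u)
    have e : (1 - s N * u) * (s N / (1 - s N * u)) = s N := by field_simp
    linear_combination q * e

open Polynomial in
lemma prod_sum_coeff (N : ℕ) (s : ℕ → ℝ) :
    (∏ j ∈ Finset.range N, (1 - C (s j) * X)).coeff 1 = - ∑ j ∈ Finset.range N, s j := by
  have := prod_deriv N s 0 (by simp)
  rw [← coeff_zero_eq_eval_zero, coeff_derivative] at this
  simpa [eval_prod] using this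

lemma abs_one_sub_le (x u : ℝ) (hx : 0 ≤ x) : |1 - x * u| ≤ exp (x * |u|) := by
  calc |1 - x * u| ≤ |1| + |x * u| := abs_sub _ _
    _ = x * |u| + 1 := by rw [abs_one, abs_mul, abs_of_nonneg hx]; ring
    _ ≤ _ := Real.add_one_le_exp _

lemma prod_bound (N : ℕ) (s : ℕ → ℝ) (hs : ∀ j, 0 ≤ s j) (hN : ∀ j, N ≤ j → s j = 0) (u : ℝ) {i k : ℕ} (hik : i ≠ k) :
    |∏ j ∈ Finset.range N, (1 - s j * u)| ≤
      |1 - s i * u| * |1 - s k * u| * exp ((∑ j ∈ Finset.range N, s j) * |u|) := by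
  set L := max N (max (i+1) (k+1))
  have hL : N ≤ L := le_max_left _ _
  have hiL : i ∈ Finset.range L := by
    rw [Finset.mem_range]; exact lt_of_lt_of_le (Nat.lt_succ_self i) ((le_max_left _ _).trans (le_max_right _ _))
  have hkL : k ∈ (Finset.range L).erase i := by
    rw [Finset.mem_erase, Finset.mem_range]
    exact ⟨hik.symm, lt_of_lt_of_le (Nat.lt_succ_self k) ((le_max_right _ _).trans (le_max_right _ _))⟩
  have e1 : ∏ j ∈ Finset.range N, (1 - s j * u) = ∏ j ∈ Finset.range L, (1 - s j * u) := by
    apply Finset.prod_subset (Finset.range_mono hL)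
    intro j _ hj
    rw [hN j (by simpa using hj)]; simp
  have e2 : ∑ j ∈ Finset.range N, s j = ∑ j ∈ Finset.range L, s j := by
    apply Finset.sum_subset (Finset.range_mono hL)
    intro j _ hj
    rw [hN j (by simpa using hj)]
  rw [e1, e2, ← Finset.mul_prod_erase _ _ hiL, ← Finset.mul_prod_erase _ _ hkL, abs_mul, abs_mul,
    ← mul_assoc]
  apply mul_le_mul_of_nonneg_left _ (by positivity)
  rw [Finset.abs_prod]
  calc _ ≤ ∏ j ∈ ((Finset.range L).erase i).erase k, exp (s j * |u|) := by
        apply Finset.prod_le_prod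
        · intros; positivity
        · intro j _; exact abs_one_sub_le _ _ (hs j)
    _ = exp (∑ j ∈ ((Finset.range L).erase i).erase k, s j * |u|) := (Real.exp_sum _ _).symm
    _ ≤ _ := by
      apply Real.exp_le_exp.mpr
      rw [Finset.sum_mul]
      apply Finset.sum_le_sum_of_subset_of_nonneg
      · exact (Finset.erase_subset _ _).trans (Finset.erase_subset _ _)
      · intro j _ _; exact mul_nonneg (hs j) (abs_nonneg _)

lemma elem_bound {R : ℝ} {x : ℝ} (hx : |x| ≤ R) :
    ‖(1 - x) * exp x - 1‖ ≤ x ^ 2 * exp R := by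
  have h1 : 1 - x ≤ exp (-x) := by linarith [Real.add_one_le_exp (-x)]
  have h2 : (1 - x) * exp x ≤ 1 := by
    calc _ ≤ exp (-x) * exp x := by gcongr
      _ = 1 := by rw [← Real.exp_add]; simp
  rw [Real.norm_eq_abs, abs_of_nonpos (by linarith)]
  have h3 : x + 1 ≤ exp x := Real.add_one_le_exp x
  have h4 : exp x ≤ exp R := Real.exp_le_exp.mpr ((le_abs_self x).trans hx)
  have hp := Real.exp_pos x
  have h6 : x ^ 2 * exp x ≤ x ^ 2 * exp R := by gcongr
  by_cases hx1 : -1 ≤ x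
  · have : 1 ≤ (1 - x + x^2) * exp x := by
      have : (1 - x + x^2) * (x + 1) ≤ (1 - x + x^2) * exp x :=
        mul_le_mul_of_nonneg_left h3 (by nlinarith [sq_nonneg (x - 1/2)])
      by_cases h0 : 0 ≤ x
      · nlinarith [pow_nonneg h0 3]
      · have hb := Real.abs_exp_sub_one_sub_id_le (x := -x) (by rw [abs_neg, abs_le]; constructor <;> linarith)
        have hb2 := (abs_le.mp hb).2
        have : exp (-x) ≤ 1 - x + x^2 := by nlinarith
        calc (1:ℝ) = exp (-x) * exp x := by rw [← Real.exp_add]; simp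
          _ ≤ _ := by gcongr
    linarith
  · push Not at hx1
    have hR : 1 ≤ exp R := Real.one_le_exp ((abs_nonneg x).trans hx)
    have h7 : 1 ≤ x ^ 2 := by nlinarith
    have h8 : 0 ≤ (1 - x) * exp x := mul_nonneg (by linarith) hp.le
    nlinarith

structure Core (a b : ℝ) (s : ℕ → ℝ) : Prop where
  anti : Antitone s
  nonneg : ∀ j, 0 ≤ s j
  summ : Summable s
  le : ∑' j, s j ≤ -fc a b 1
  bound : ∀ i k, i ≠ k → ∀ u, |EE a b 0 u| ≤ |1 - s i * u| * |1 - s k * u| * exp (-fc a b 1 * |u|)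
  sqsumm : Summable (fun j => s j ^ 2)
  prod : ∀ u, EE a b 0 u * exp (-fc a b 1 * u) = ∏' j, (1 + ((1 - s j * u) * exp (s j * u) - 1))
  logd : ∀ u, s 0 * |u| < 1 → EE a b 1 u + (-fc a b 1) * u * EE a b 0 u =
    - EE a b 0 u * ∑' j, (s j * u) ^ 2 / (1 - s j * u)

open Polynomial in
lemma core_exists {a b : ℝ} (ha : 0 < a) (hb : 0 < b) : ∃ s, Core a b s := by
  have hap : ∀ M : ℕ, ∃ p : ℝ[X], (∀ n, p.coeff n = gc a b (M + 1) n) ∧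
    ∃ (N : ℕ) (s : ℕ → ℝ), Antitone s ∧
    (∀ j, 0 ≤ s j) ∧ (∀ j, N ≤ j → s j = 0) ∧
    p = ∏ j ∈ Finset.range N, (1 - C (s j) * X) := fun M => approx ha hb (Nat.le_add_left 1 M)
  choose p hp N t tanti tnn tz hprod using hap
  set B := BB a b with hB
  have hB0 : 0 ≤ B := BB_nonneg ha hb
  have hsum : ∀ M, ∑ j ∈ Finset.range (N M), t M j = - gc a b (M + 1) 1 := by
    intro M
    rw [← hp M 1, hprod M, prod_sum_coeff, neg_neg]
  have hsumB : ∀ M, ∑ j ∈ Finset.range (N M), t M j ≤ B := by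
    intro M
    rw [hsum]
    have := gc_bound ha hb (Nat.le_add_left 1 M) 1
    simp at this
    exact (neg_le_abs _).trans this
  have hsumL : ∀ M L, ∑ j ∈ Finset.range L, t M j ≤ ∑ j ∈ Finset.range (N M), t M j := by
    intro M L
    have : ∑ j ∈ Finset.range (N M), t M j = ∑ j ∈ Finset.range (max L (N M)), t M j := by
      apply Finset.sum_subset (Finset.range_mono (le_max_right _ _))
      intro j _ hj
      exact tz M j (by simpa using hj)
    rw [this]
    apply Finset.sum_le_sum_of_subset_of_nonneg (Finset.range_mono (le_max_left _ _))
    intro j _ _; exact tnn M j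
  have htB : ∀ M j, t M j ≤ B / (j + 1) := by
    intro M j
    rw [le_div_iff₀ (by positivity)]
    calc t M j * (j + 1) = ∑ i ∈ Finset.range (j + 1), t M j := by
          simp; ring
      _ ≤ ∑ i ∈ Finset.range (j + 1), t M i := by
          apply Finset.sum_le_sum
          intro i hi
          exact tanti M (by simpa [Nat.lt_succ_iff] using hi)
      _ ≤ B := (hsumL M _).trans (hsumB M)
  have hcomp : IsCompact (Set.pi Set.univ (fun j : ℕ => Set.Icc (0:ℝ) (B / (j + 1)))) :=
    isCompact_univ_pi fun j => isCompact_Icc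
  obtain ⟨s, hs, φ, hφ, hlim⟩ := hcomp.tendsto_subseq (x := t)
    (fun M j _ => ⟨tnn M j, htB M j⟩)
  have hlimj : ∀ j, Filter.Tendsto (fun m => t (φ m) j) Filter.atTop (nhds (s j)) := by
    intro j
    exact (tendsto_pi_nhds.mp hlim) j
  have hφ1 : Filter.Tendsto (fun m => φ m + 1) Filter.atTop Filter.atTop :=
    (Filter.tendsto_add_atTop_nat 1).comp hφ.tendsto_atTop
  have hc1 : Filter.Tendsto (fun m => ∑ j ∈ Finset.range (N (φ m)), t (φ m) j) Filter.atTop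
      (nhds (-fc a b 1)) := by
    simp only [hsum]
    exact ((gc_tendsto 1).comp hφ1).neg
  have hE0 : ∀ u, Filter.Tendsto (fun m => ∏ j ∈ Finset.range (N (φ m)), (1 - t (φ m) j * u))
      Filter.atTop (nhds (EE a b 0 u)) := by
    intro u
    refine ((gc_sum_tendsto ha hb 0 u).comp hφ1).congr fun m => ?_
    simp only [Function.comp]
    rw [eval_gc (hp (φ m)), hprod]
    simp [eval_prod]
  have snn : ∀ j, 0 ≤ s j := fun j => (hs j (Set.mem_univ _)).1
  have sB : ∀ j, s j ≤ B / (j + 1) := fun j => (hs j (Set.mem_univ _)).2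
  have spart : ∀ L, ∑ j ∈ Finset.range L, s j ≤ -fc a b 1 := by
    intro L
    refine le_of_tendsto_of_tendsto (tendsto_finsetSum _ fun j _ => hlimj j) hc1 ?_
    exact Filter.Eventually.of_forall fun m => hsumL _ _
  have ssumm : Summable s := summable_of_sum_range_le snn spart
  have santi : Antitone s := by
    intro i j hij
    exact le_of_tendsto_of_tendsto (hlimj j) (hlimj i)
      (Filter.Eventually.of_forall fun m => tanti _ hij)
  have hsqB : Summable (fun j : ℕ => (B / (j + 1)) ^ 2) := by
    have h1 : Summable (fun j : ℕ => 1 / ((j:ℝ) + 1) ^ 2) := by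
      have := (summable_nat_add_iff 1).mpr (Real.summable_one_div_nat_pow.mpr (by norm_num : 1 < 2))
      simpa using this
    refine (h1.mul_left (B ^ 2)).congr fun j => ?_
    rw [div_pow]; ring
  refine ⟨s, santi, snn, ssumm, ?_, ?_, ?_, ?_, ?_⟩
  · exact Real.tsum_le_of_sum_range_le snn spart
  · intro i k hik u
    refine le_of_tendsto_of_tendsto (hE0 u).abs
      ((((hlimj i).mul_const u).const_sub 1).abs.mul (((hlimj k).mul_const u).const_sub 1).abs |>.mul
        ((Real.continuous_exp.tendsto _).comp (hc1.mul_const |u|))) ?_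
    exact Filter.Eventually.of_forall fun m => prod_bound _ _ (tnn _) (tz _) u hik
  · refine hsqB.of_nonneg_of_le (fun j => sq_nonneg _) fun j => ?_
    exact pow_le_pow_left₀ (snn j) (sB j) 2
  · intro u
    have l1 := (hE0 u).mul ((Real.continuous_exp.tendsto _).comp (hc1.mul_const u))
    have l2 : Filter.Tendsto (fun m => ∏' j, (1 + ((1 - t (φ m) j * u) * exp (t (φ m) j * u) - 1)))
        Filter.atTop (nhds (∏' j, (1 + ((1 - s j * u) * exp (s j * u) - 1)))) := by
      apply tendsto_tprod_one_add_of_dominated_convergence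
        (bound := fun j : ℕ => (B / (j + 1)) ^ 2 * (u ^ 2 * exp (B * |u|))) (hsqB.mul_right _)
      · intro j
        have := (hlimj j).mul_const u
        exact ((this.const_sub 1).mul ((Real.continuous_exp.tendsto _).comp this)).sub_const 1
      · refine Filter.Eventually.of_forall fun m j => ?_
        have hj : (1:ℝ) ≤ j + 1 := by
          have : (0:ℝ) ≤ j := j.cast_nonneg
          linarith
        have h1 : |t (φ m) j * u| ≤ B * |u| := by
          rw [abs_mul, abs_of_nonneg (tnn _ _)]
          apply mul_le_mul_of_nonneg_right _ (abs_nonneg _)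
          exact (htB _ _).trans (div_le_self hB0 hj)
        refine (elem_bound h1).trans ?_
        rw [mul_pow, mul_assoc]
        apply mul_le_mul_of_nonneg_right _ (by positivity)
        exact pow_le_pow_left₀ (tnn _ _) (htB _ _) 2
    refine tendsto_nhds_unique l1 (l2.congr fun m => ?_)
    rw [tprod_eq_prod (s := Finset.range (N (φ m)))]
    · simp only [Function.comp, add_sub_cancel]
      rw [Finset.prod_mul_distrib, ← Real.exp_sum, Finset.sum_mul]
    · intro j hj
      rw [tz _ j (by simpa using hj)]; simp
  · intro u hu
    have l0 := hE0 u
    have l1 : Filter.Tendsto (fun m => u * (derivative (p (φ m))).eval u)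
      Filter.atTop (nhds (EE a b 1 u)) := by
      refine ((gc_sum_tendsto ha hb 1 u).comp hφ1).congr fun m => ?_
      simp only [Function.comp]
      rw [eval_gc1 (hp (φ m))]
    obtain ⟨ρ, hρ1, hρ2⟩ := exists_between hu
    have hev : ∀ᶠ m in Filter.atTop, t (φ m) 0 * |u| < ρ :=
      ((hlimj 0).mul_const |u|).eventually (gt_mem_nhds hρ1)
    have hev2 : ∀ m, t (φ m) 0 * |u| < ρ → ∀ j, 1 - ρ ≤ 1 - t (φ m) j * u := by
      intro m hm j
      have h1 : t (φ m) j * u ≤ t (φ m) j * |u| := mul_le_mul_of_nonneg_left (le_abs_self u) (tnn _ _)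
      have h2 : t (φ m) j * |u| ≤ t (φ m) 0 * |u| :=
        mul_le_mul_of_nonneg_right (tanti _ (Nat.zero_le j)) (abs_nonneg _)
      linarith
    have h1s : ∀ j, 1 - ρ ≤ 1 - s j * u := by
      intro j
      refine ge_of_tendsto (((hlimj j).mul_const u).const_sub 1) ?_
      filter_upwards [hev] with m hm using hev2 m hm j
    have l2 : Filter.Tendsto (fun m => ∑' j, (t (φ m) j * u) ^ 2 / (1 - t (φ m) j * u))
        Filter.atTop (nhds (∑' j, (s j * u) ^ 2 / (1 - s j * u))) := by
      apply tendsto_tsum_of_dominated_convergence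
        (bound := fun j : ℕ => (B / (j + 1)) ^ 2 * (u ^ 2 / (1 - ρ))) (hsqB.mul_right _)
      · intro j
        have := (hlimj j).mul_const u
        exact (this.pow 2).div (this.const_sub 1) (by linarith [h1s j])
      · filter_upwards [hev] with m hm j
        have h3 := hev2 m hm j
        have h4 : 0 < 1 - ρ := by linarith
        rw [Real.norm_eq_abs, abs_of_nonneg (div_nonneg (sq_nonneg _) (by linarith)), mul_pow, mul_div_assoc]
        have h5 : u ^ 2 / (1 - t (φ m) j * u) ≤ u ^ 2 / (1 - ρ) :=
          div_le_div_of_nonneg_left (sq_nonneg u) h4 h3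
        apply mul_le_mul (pow_le_pow_left₀ (tnn _ _) (htB _ _) 2) h5 (div_nonneg (sq_nonneg _) (by linarith)) (by positivity)
    refine tendsto_nhds_unique (l1.add ((hc1.mul_const u).mul l0)) ((l0.neg.mul l2).congr' ?_)
    filter_upwards [hev] with m hm
    have hne : ∀ j, 1 - t (φ m) j * u ≠ 0 := fun j => by
      have := hev2 m hm j
      intro h
      linarith
    have hd := prod_deriv (N (φ m)) (t (φ m)) u hne
    rw [← hprod] at hd
    have hev0 : (p (φ m)).eval u = ∏ j ∈ Finset.range (N (φ m)), (1 - t (φ m) j * u) := by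
      rw [hprod]; simp [eval_prod]
    rw [hd, hev0, tsum_eq_sum (s := Finset.range (N (φ m)))]
    · set P := ∏ j ∈ Finset.range (N (φ m)), (1 - t (φ m) j * u)
      have : ∑ j ∈ Finset.range (N (φ m)), (t (φ m) j * u) ^ 2 / (1 - t (φ m) j * u) =
          u * ∑ j ∈ Finset.range (N (φ m)), t (φ m) j / (1 - t (φ m) j * u) -
          (∑ j ∈ Finset.range (N (φ m)), t (φ m) j) * u := by
        rw [Finset.mul_sum, Finset.sum_mul, ← Finset.sum_sub_distrib]
        apply Finset.sum_congr rfl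
        intro j _
        have := hne j
        field_simp
        ring
      rw [this]; ring
    · intro j hj
      rw [tz _ j (by simpa using hj)]; simp


lemma EE_hasDerivAt {a b : ℝ} (ha : 0 < a) (hb : 0 < b) (u : ℝ) :
    ∃ d, HasDerivAt (EE a b 0) d u ∧ u * d = EE a b 1 u := by
  refine ⟨∑' n : ℕ, fc a b n * (n:ℝ) ^ 0 * (n * u ^ (n - 1)), ?_, ?_⟩
  · have hR : (1:ℝ) ≤ |u| + 1 := by linarith [abs_nonneg u]
    refine hasDerivAt_tsum_of_isPreconnected (t := Metric.ball 0 (|u| + 1)) (y₀ := 0)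
      (u := fun n : ℕ => (BB a b * 2 ^ 1 * |(|u| + 1)|) ^ n / n.factorial)
      (g := fun n y => fc a b n * (n:ℝ) ^ 0 * y ^ n)
      (g' := fun n y => fc a b n * (n:ℝ) ^ 0 * (n * y ^ (n - 1)))
      (Real.summable_pow_div_factorial _) Metric.isOpen_ball
      (convex_ball _ _).isPreconnected ?_ ?_ (by simp; linarith) (EE_summable ha hb 0 0) (by simp)
    · intro n y _
      exact (hasDerivAt_pow n y).const_mul _
    · intro n y hy
      refine le_trans ?_ (term_bound n 1 (|u| + 1) (BB_nonneg ha hb) (fc_bound ha hb n))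
      simp only [Metric.mem_ball, dist_zero_right, Real.norm_eq_abs] at hy
      simp only [Real.norm_eq_abs, pow_zero, mul_one, pow_one, mul_assoc, abs_mul, abs_pow]
      apply mul_le_mul_of_nonneg_left _ (abs_nonneg _)
      apply mul_le_mul_of_nonneg_left _ (abs_nonneg _)
      rw [abs_of_nonneg (by linarith : 0 ≤ |u| + 1)]
      calc |y| ^ (n - 1) ≤ (|u| + 1) ^ (n - 1) := by gcongr
        _ ≤ _ := pow_le_pow_right₀ hR (Nat.sub_le _ _)
  · unfold EE
    rw [← tsum_mul_left]
    congr 1; ext n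
    cases n with
    | zero => simp
    | succ n => simp [pow_succ]; ring

lemma tsum_sq_le {f : ℕ → ℝ} (hf : ∀ n, 0 ≤ f n) (hs : Summable f) :
    Summable (fun n => f n ^ 2) ∧ ∑' n, f n ^ 2 ≤ (∑' n, f n) ^ 2 := by
  have h : ∀ n, f n ^ 2 ≤ f n * ∑' n, f n := fun n => by
    rw [sq]; exact mul_le_mul_of_nonneg_left (hs.le_tsum n fun j _ => hf j) (hf n)
  have h1 : Summable (fun n => f n ^ 2) :=
    (hs.mul_right _).of_nonneg_of_le (fun n => sq_nonneg _) h
  refine ⟨h1, ?_⟩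
  rw [sq, ← tsum_mul_right]
  exact h1.tsum_le_tsum h (hs.mul_right _)

lemma EE_growth {a b : ℝ} (ha : 0 < a) (hb : 1 ≤ b) {y : ℝ} (hy : 0 ≤ y) :
    EE a b 0 (-(a * y ^ 2)) ≤ exp (2 * y) := by
  have hb0 : 0 < b := by linarith
  have hs : Summable (fun n : ℕ => y ^ n / n.factorial) := Real.summable_pow_div_factorial y
  obtain ⟨h1, h2⟩ := tsum_sq_le (fun n => by positivity) hs
  have h3 : ∑' n : ℕ, y ^ n / n.factorial = exp y := by
    rw [Real.exp_eq_exp_ℝ, NormedSpace.exp_eq_tsum_div]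
  calc EE a b 0 (-(a * y ^ 2)) ≤ ∑' n : ℕ, (y ^ n / n.factorial) ^ 2 := by
        apply (EE_summable ha hb0 0 _).tsum_le_tsum _ h1
        intro n
        refine (le_abs_self _).trans ?_
        rw [abs_mul, abs_mul, fc_abs ha hb0, pow_zero, abs_one, mul_one, abs_pow, abs_neg,
          abs_of_nonneg (by positivity : 0 ≤ a * y ^ 2)]
        have p1 := pow_le_poch ha n
        have p2 : (n.factorial : ℝ) ≤ poch b (2 * n) :=
          le_trans (by exact_mod_cast Nat.factorial_le (by omega)) (factorial_le_poch hb (2 * n))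
        have p3 := poch_pos ha n
        calc _ ≤ 1 / (n.factorial * a ^ n * n.factorial) * (a * y ^ 2) ^ n := by gcongr
          _ = _ := by rw [mul_pow, ← pow_mul, mul_comm 2 n, pow_mul]; field_simp
    _ ≤ _ := h2
    _ = _ := by rw [h3, sq, ← Real.exp_add]; ring_nf

lemma Core.norm_summable {a b : ℝ} {s : ℕ → ℝ} (h : Core a b s) (u : ℝ) :
    Summable (fun j => ‖(1 - s j * u) * exp (s j * u) - 1‖) := by
  refine (h.sqsumm.mul_right (u ^ 2 * exp (s 0 * |u|))).of_nonneg_of_le (fun _ => norm_nonneg _) ?_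
  intro j
  have h1 : |s j * u| ≤ s 0 * |u| := by
    rw [abs_mul, abs_of_nonneg (h.nonneg j)]
    exact mul_le_mul_of_nonneg_right (h.anti (Nat.zero_le j)) (abs_nonneg _)
  refine (elem_bound h1).trans (le_of_eq ?_)
  ring

lemma Core.sum_eq {a b : ℝ} (ha : 0 < a) (hb : 1 ≤ b) {s : ℕ → ℝ} (h : Core a b s) :
    ∑' j, s j = - fc a b 1 := by
  refine le_antisymm h.le ?_
  set c := -fc a b 1 with hc
  set S := ∑' j, s j with hS
  have key : ∀ y : ℝ, 0 ≤ y → (c - S) * a * y ^ 2 ≤ 2 * y := by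
    intro y hy
    set r := a * y ^ 2 with hr
    have hr0 : 0 ≤ r := by positivity
    have h1 := h.prod (-r)
    have hm := multipliable_one_add_of_summable (h.norm_summable (-r))
    have h2 : exp (-(S * r)) ≤ ∏' j, (1 + ((1 - s j * (-r)) * exp (s j * (-r)) - 1)) := by
      refine ge_of_tendsto' hm.hasProd.tendsto_prod_nat fun n => ?_
      calc exp (-(S * r)) ≤ exp (∑ j ∈ Finset.range n, s j * (-r)) := by
            apply Real.exp_le_exp.mpr
            rw [← Finset.sum_mul]
            have := h.summ.sum_le_tsum (Finset.range n) (fun j _ => h.nonneg j)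
            nlinarith
        _ = ∏ j ∈ Finset.range n, exp (s j * (-r)) := Real.exp_sum _ _
        _ ≤ _ := by
            apply Finset.prod_le_prod
            · intros; positivity
            · intro j _
              have := mul_nonneg (h.nonneg j) hr0
              have hp := Real.exp_pos (s j * (-r))
              nlinarith
    rw [← h1] at h2
    have h3 := EE_growth ha hb hy
    rw [← hr] at h3
    have h4 : exp (-(S * r)) ≤ exp (2 * y + c * (-r)) := by
      rw [Real.exp_add]
      exact h2.trans (mul_le_mul_of_nonneg_right h3 (Real.exp_pos _).le)
    have h5 := Real.exp_le_exp.mp h4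
    rw [mul_assoc, ← hr]
    linarith
  by_contra hlt
  push Not at hlt
  have hδ : 0 < (c - S) * a := mul_pos (by linarith) ha
  have := key (3 / ((c - S) * a)) (by positivity)
  have e : (c - S) * a * (3 / ((c - S) * a)) ^ 2 = 3 * (3 / ((c - S) * a)) := by
    field_simp
  rw [e] at this
  have : 0 < 3 / ((c - S) * a) := by positivity
  linarith

lemma Core.zero_of {a b : ℝ} {s : ℕ → ℝ} (h : Core a b s) {u : ℝ} {j : ℕ} (hj : s j * u = 1) :
    EE a b 0 u = 0 := by
  have := h.bound j (j + 1) (by omega) u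
  rw [hj] at this
  simp at this
  exact this

lemma Core.of_zero {a b : ℝ} {s : ℕ → ℝ} (h : Core a b s) {u : ℝ} (hu : EE a b 0 u = 0) :
    ∃ j, s j * u = 1 := by
  by_contra hne
  push Not at hne
  have h1 := h.prod u
  rw [hu, zero_mul] at h1
  refine tprod_one_add_ne_zero_of_summable ?_ (h.norm_summable u) h1.symm
  intro j hj
  rw [add_sub_cancel] at hj
  rcases mul_eq_zero.mp hj with h2 | h2
  · exact hne j (by linarith)
  · exact (Real.exp_pos _).ne' h2

lemma Core.inj {a b : ℝ} (ha : 0 < a) (hb : 0 < b) {s : ℕ → ℝ} (h : Core a b s) {i k : ℕ}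
    (hi : 0 < s i) (hik : s i = s k) : i = k := by
  by_contra hne
  set u := 1 / s i with hu
  have hsu : s i * u = 1 := by rw [hu]; field_simp
  have h0 := h.zero_of hsu
  obtain ⟨d, hd, hd1⟩ := EE_hasDerivAt ha hb u
  have hO : (EE a b 0) =O[nhds u] fun x => ‖x - u‖ ^ 2 := by
    have hcont : Filter.Tendsto (fun x : ℝ => exp (-fc a b 1 * |x|)) (nhds u)
        (nhds (exp (-fc a b 1 * |u|))) :=
      Continuous.tendsto (by fun_prop) u
    have hev := hcont.eventually (gt_mem_nhds (lt_add_one _))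
    refine Asymptotics.IsBigO.of_bound (s i ^ 2 * (exp (-fc a b 1 * |u|) + 1)) ?_
    filter_upwards [hev] with x hx
    have hb1 := h.bound i k hne x
    rw [← hik] at hb1
    have e : 1 - s i * x = - s i * (x - u) := by linarith
    rw [e, abs_mul, abs_neg, abs_of_pos hi] at hb1
    rw [Real.norm_eq_abs, Real.norm_eq_abs, Real.norm_eq_abs, abs_of_nonneg (sq_nonneg |x - u|)]
    calc _ ≤ _ := hb1
      _ ≤ s i * |x - u| * (s i * |x - u|) * (exp (-fc a b 1 * |u|) + 1) := by gcongr
      _ = _ := by ring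
  have hd0 : HasFDerivAt (EE a b 0) (0 : ℝ →L[ℝ] ℝ) u := hO.hasFDerivAt (by norm_num)
  have hd2 : HasDerivAt (EE a b 0) 0 u := by
    rw [hasDerivAt_iff_hasFDerivAt]; simpa using hd0
  have : d = 0 := hd.unique hd2
  rw [this, mul_zero] at hd1
  exact EE_simple ha hb h0 hd1.symm

lemma Core.expansion {a b : ℝ} (ha : 0 < a) (hb : 1 ≤ b) {s : ℕ → ℝ} (h : Core a b s) {u : ℝ}
    (hu : 0 ≤ u) (hsu : s 0 * u < 1) :
    EE a b 0 u ≠ 0 ∧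
    HasSum (fun k : ℕ => (∑' j, s j ^ (k + 1)) * u ^ (k + 1)) (-(EE a b 1 u / EE a b 0 u)) := by
  have hle : ∀ j, s j * u ≤ s 0 * u := fun j =>
    mul_le_mul_of_nonneg_right (h.anti (Nat.zero_le j)) hu
  have hnn : ∀ j, 0 ≤ s j * u := fun j => mul_nonneg (h.nonneg j) hu
  have hne : EE a b 0 u ≠ 0 := by
    intro h0
    obtain ⟨j, hj⟩ := h.of_zero h0
    have := hle j
    linarith
  refine ⟨hne, ?_⟩
  have hgeo : ∀ j, HasSum (fun k : ℕ => (s j * u) ^ (k + 1)) (s j * u / (1 - s j * u)) := by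
    intro j
    have := (hasSum_geometric_of_lt_one (hnn j) (by linarith [hle j])).mul_left (s j * u)
    simpa [pow_succ', div_eq_mul_inv] using this
  have hs1 : Summable (fun j => s j * u / (1 - s j * u)) := by
    refine ((h.summ.mul_right u).mul_right (1 / (1 - s 0 * u))).of_nonneg_of_le
      (fun j => div_nonneg (hnn j) (by linarith [hle j])) fun j => ?_
    rw [mul_one_div]
    exact div_le_div_of_nonneg_left (hnn j) (by linarith) (by linarith [hle j])
  have hsq : Summable (fun j => (s j * u) ^ 2 / (1 - s j * u)) := by
    refine (hs1.sub (h.summ.mul_right u)).congr fun j => ?_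
    have : 1 - s j * u ≠ 0 := by linarith [hle j]
    field_simp; ring
  have hlog := h.logd u (by rwa [abs_of_nonneg hu])
  have etot : -(EE a b 1 u / EE a b 0 u) = ∑' j, s j * u / (1 - s j * u) := by
    have e1 : ∑' j, s j * u / (1 - s j * u) = (∑' j, s j) * u + ∑' j, (s j * u) ^ 2 / (1 - s j * u) := by
      rw [← tsum_mul_right, ← (h.summ.mul_right u).tsum_add hsq]
      congr 1; ext j
      have : 1 - s j * u ≠ 0 := by linarith [hle j]
      field_simp; ring
    rw [e1, h.sum_eq ha hb, ← neg_div, div_eq_iff hne]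
    linarith
  have hprod : Summable (fun x : ℕ × ℕ => (s x.1 * u) ^ (x.2 + 1)) := by
    rw [summable_prod_of_nonneg (fun x => pow_nonneg (hnn _) _)]
    exact ⟨fun j => (hgeo j).summable, hs1.congr fun j => (hgeo j).tsum_eq.symm⟩
  have hsym := hprod.prod_symm
  have htot : ∑' x : ℕ × ℕ, (s x.2 * u) ^ (x.1 + 1) = ∑' j, s j * u / (1 - s j * u) := by
    have h1 := (Equiv.prodComm ℕ ℕ).tsum_eq (fun x : ℕ × ℕ => (s x.1 * u) ^ (x.2 + 1))
    simp only [Equiv.prodComm_apply, Prod.fst_swap, Prod.snd_swap] at h1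
    rw [h1, hprod.tsum_prod]
    congr 1; ext j; exact (hgeo j).tsum_eq
  rw [etot, ← htot]
  have := hsym.hasSum.prod_fiberwise (fun k => (hsym.prod_factor k).hasSum)
  simp only [Prod.swap_prod_mk, Prod.fst_swap, Prod.snd_swap] at this
  convert this using 1
  ext k
  rw [← tsum_mul_right]
  congr 1; ext j; rw [mul_pow]


lemma ps_summable {c : ℕ → ℝ} {R : ℝ} (hc : ∀ n, 0 ≤ c n)
    (hs : ∀ x ∈ Ioo 0 R, Summable fun n => c n * x ^ n) {x : ℝ} (hx : x ∈ Ioo 0 R) :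
    Summable fun n : ℕ => ((n:ℝ) + 1) * c (n + 1) * x ^ n := by
  obtain ⟨r, hxr, hrR⟩ := exists_between hx.2
  have hx0 := hx.1
  have hr0 : 0 < r := hx0.trans hxr
  have hq : x / r < 1 := (div_lt_one hr0).2 hxr
  obtain ⟨C, hC⟩ := (tendsto_self_mul_const_pow_of_lt_one (div_nonneg hx0.le hr0.le) hq).bddAbove_range
  have hs1 := ((summable_nat_add_iff 1).2 (hs r ⟨hr0, hrR⟩)).mul_left (C / x)
  refine hs1.of_nonneg_of_le (fun n => by have := hc (n + 1); positivity) fun n => ?_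
  have h1 : ((n + 1 : ℕ):ℝ) * (x / r) ^ (n + 1) ≤ C := hC ⟨n + 1, rfl⟩
  have h2 : ((n:ℝ) + 1) * x ^ n = ((n + 1 : ℕ):ℝ) * (x / r) ^ (n + 1) * (r ^ (n + 1) / x) := by
    rw [div_pow]; push_cast; field_simp; ring
  calc ((n:ℝ) + 1) * c (n + 1) * x ^ n = c (n + 1) * (((n:ℝ) + 1) * x ^ n) := by ring
    _ ≤ c (n + 1) * (C * (r ^ (n + 1) / x)) := by
      apply mul_le_mul_of_nonneg_left _ (hc _)
      rw [h2]
      exact mul_le_mul_of_nonneg_right h1 (by positivity)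
    _ = _ := by ring

lemma ps_deriv {c : ℕ → ℝ} {R : ℝ} (hc : ∀ n, 0 ≤ c n)
    (hs : ∀ x ∈ Ioo 0 R, Summable fun n => c n * x ^ n) {x : ℝ} (hx : x ∈ Ioo 0 R) :
    HasDerivAt (fun x => ∑' n, c n * x ^ n) (∑' n : ℕ, ((n:ℝ) + 1) * c (n + 1) * x ^ n) x := by
  obtain ⟨r, hxr, hrR⟩ := exists_between hx.2
  have hx0 := hx.1
  have hr0 : 0 < r := hx0.trans hxr
  have e1 : ∀ (y : ℝ) (n : ℕ), c (n + 1) * (((n + 1 : ℕ):ℝ) * y ^ (n + 1 - 1))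
      = ((n:ℝ) + 1) * c (n + 1) * y ^ n := fun y n => by
    push_cast; ring
  have hsum : ∀ y ∈ Ioo 0 R, Summable fun n : ℕ => c n * (n * y ^ (n - 1)) := by
    intro y hy
    rw [← summable_nat_add_iff 1]
    simp only [e1]
    exact ps_summable hc hs hy
  have key : HasDerivAt (fun x => ∑' n, c n * x ^ n) (∑' n : ℕ, c n * (n * x ^ (n - 1))) x := by
    refine hasDerivAt_tsum_of_isPreconnected (t := Ioo 0 r) (y₀ := x)
      (u := fun n : ℕ => c n * (n * r ^ (n - 1)))
      (g := fun n y => c n * y ^ n)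
      (g' := fun n y => c n * (n * y ^ (n - 1)))
      (hsum r ⟨hr0, hrR⟩) isOpen_Ioo isPreconnected_Ioo ?_ ?_ ⟨hx0, hxr⟩ (hs x hx) ⟨hx0, hxr⟩
    · intro n y _
      exact (hasDerivAt_pow n y).const_mul _
    · intro n y hy
      have hy0 := hy.1.le
      rw [Real.norm_eq_abs, abs_of_nonneg (by have := hc n; positivity)]
      have := hc n
      have := hy.2.le
      gcongr
  rw [(hsum x hx).tsum_eq_zero_add] at key
  simpa only [e1, Nat.cast_zero, zero_mul, mul_zero, zero_add] using key

lemma ps_iter {R : ℝ} (k : ℕ) : ∀ {c : ℕ → ℝ} {f : ℝ → ℝ}, (∀ n, 0 ≤ c n) →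
    (∀ x ∈ Ioo 0 R, HasSum (fun n => c n * x ^ n) (f x)) →
    DifferentiableOn ℝ (iteratedDerivWithin k f (Ioo 0 R)) (Ioo 0 R) ∧
      ∀ x ∈ Ioo 0 R, 0 ≤ iteratedDerivWithin k f (Ioo 0 R) x := by
  have hder : ∀ {c : ℕ → ℝ} {f : ℝ → ℝ}, (∀ n, 0 ≤ c n) →
    (∀ x ∈ Ioo 0 R, HasSum (fun n => c n * x ^ n) (f x)) → ∀ x ∈ Ioo 0 R,
      HasDerivAt f (∑' n : ℕ, ((n:ℝ) + 1) * c (n + 1) * x ^ n) x := by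
    intro c f hc hs x hx
    refine (ps_deriv hc (fun x hx => (hs x hx).summable) hx).congr_of_eventuallyEq ?_
    filter_upwards [isOpen_Ioo.mem_nhds hx] with y hy
    exact (hs y hy).tsum_eq.symm
  induction k with
  | zero =>
    intro c f hc hs
    simp only [iteratedDerivWithin_zero]
    refine ⟨fun x hx => (hder hc hs x hx).differentiableAt.differentiableWithinAt, fun x hx => ?_⟩
    exact (hs x hx).nonneg fun n => mul_nonneg (hc n) (pow_nonneg hx.1.le n)
  | succ k ih =>
    intro c f hc hs
    rw [iteratedDerivWithin_succ']
    refine ih (c := fun n => ((n:ℝ) + 1) * c (n + 1))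
      (fun n => mul_nonneg (by positivity) (hc _)) fun x hx => ?_
    rw [derivWithin_of_isOpen isOpen_Ioo hx, (hder hc hs x hx).deriv]
    exact (ps_summable hc (fun x hx => (hs x hx).summable) hx).hasSum

lemma Gamma_poch {a : ℝ} (ha : 0 < a) (n : ℕ) :
    Real.Gamma (a + n) = poch a n * Real.Gamma a := by
  induction n with
  | zero => simp [poch_zero]
  | succ n ih =>
    have : a + ((n + 1 : ℕ):ℝ) = (a + n) + 1 := by push_cast; ring
    rw [this, Real.Gamma_add_one (by positivity), ih, poch_succ]; ring

lemma Wcal_eq {ν : ℝ} (hν : -1 < ν) (x : ℝ) :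
    Wcal ν x = EE (ν + 1) (ν + 2) 0 (x ^ 4 / 16) := by
  unfold Wcal EE
  congr 1; ext n
  have ha : 0 < ν + 1 := by linarith
  have hb : 0 < ν + 2 := by linarith
  have h1 : Real.Gamma (ν + n + 1) = poch (ν + 1) n * Real.Gamma (ν + 1) := by
    rw [← Gamma_poch ha]; congr 1; ring
  have h2 : Real.Gamma (ν + 2 * n + 2) = poch (ν + 2) (2 * n) * Real.Gamma (ν + 2) := by
    rw [← Gamma_poch hb]; congr 1; push_cast; ring
  have g1 := (Real.Gamma_pos_of_pos ha).ne'
  have g2 := (Real.Gamma_pos_of_pos hb).ne'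
  have p1 := (poch_pos ha n).ne'
  have p2 := (poch_pos hb (2 * n)).ne'
  have hf : (n.factorial : ℝ) ≠ 0 := by positivity
  have h16 : (2:ℝ) ^ (4 * n) = 16 ^ n := by rw [pow_mul]; norm_num
  rw [h1, h2, h16, fc, div_pow, ← pow_mul]
  field_simp

lemma Wcal_deriv {ν : ℝ} (hν : -1 < ν) (x : ℝ) :
    x * deriv (Wcal ν) x = 4 * EE (ν + 1) (ν + 2) 1 (x ^ 4 / 16) := by
  obtain ⟨d, hd, hd1⟩ := EE_hasDerivAt (a := ν + 1) (b := ν + 2) (by linarith) (by linarith)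
    (x ^ 4 / 16)
  have hW : Wcal ν = fun x => EE (ν + 1) (ν + 2) 0 (x ^ 4 / 16) := funext fun x => Wcal_eq hν x
  have h1 : HasDerivAt (fun x : ℝ => x ^ 4 / 16) ((4:ℕ) * x ^ (4 - 1) / 16) x :=
    (hasDerivAt_pow 4 x).div_const 16
  have h2 := HasDerivAt.comp x hd h1
  have h3 : deriv (Wcal ν) x = d * ((4:ℕ) * x ^ (4 - 1) / 16) := by
    rw [hW]; exact h2.deriv
  rw [h3, ← hd1]; push_cast; ring

lemma zeta_match {ν : ℝ} (hν : -1 < ν) {γ : ℕ → ℝ}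
    (hγpos : ∀ n, 1 ≤ n → 0 < γ n)
    (hγmono : ∀ m n, 1 ≤ m → m < n → γ m < γ n)
    (hγzero : ∀ n, 1 ≤ n → Wcal ν (γ n) = 0)
    (hγall : ∀ x : ℝ, 0 < x → Wcal ν x = 0 → ∃ n, 1 ≤ n ∧ x = γ n)
    {s : ℕ → ℝ} (hs : Core (ν + 1) (ν + 2) s) :
    s 0 * (γ 1 ^ 4 / 16) ≤ 1 ∧
    ∀ k : ℕ, ∑' j, s j ^ (k + 1) = 16 ^ (k + 1) * ∑' n : ℕ, 1 / γ (n + 1) ^ (4 * (k + 1)) := by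
  have ha : 0 < ν + 1 := by linarith
  have hb : 0 < ν + 2 := by linarith
  have hex : ∀ n : ℕ, ∃ j, s j * (γ (n + 1) ^ 4 / 16) = 1 := fun n =>
    hs.of_zero (by rw [← Wcal_eq hν]; exact hγzero _ (by omega))
  choose e he using hex
  have hp : ∀ n : ℕ, 0 < γ (n + 1) := fun n => hγpos _ (by omega)
  have hse : ∀ n, s (e n) = 16 / γ (n + 1) ^ 4 := fun n => by
    have := hp n
    have h := he n
    field_simp at h ⊢
    linarith
  have hsm : StrictMono fun n : ℕ => γ (n + 1) := fun m n hmn =>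
    hγmono _ _ (by omega) (by omega)
  have hinj : Function.Injective e := by
    intro m n hmn
    have h1 := hse m
    rw [hmn, hse n] at h1
    have hm := hp m
    have hn := hp n
    have h2 : γ (m + 1) ^ 4 = γ (n + 1) ^ 4 := by field_simp at h1; linarith
    exact hsm.injective ((pow_left_inj₀ hm.le hn.le (by norm_num)).1 h2)
  have hsurj : ∀ j, 0 < s j → ∃ n, e n = j := by
    intro j hj
    set x : ℝ := (16 / s j) ^ ((1:ℝ) / 4) with hx
    have hx0 : 0 < x := by positivity
    have hx4 : x ^ 4 = 16 / s j := by
      rw [hx, ← Real.rpow_natCast, ← Real.rpow_mul (by positivity)]; norm_num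
    have hz : Wcal ν x = 0 := by
      rw [Wcal_eq hν]; apply hs.zero_of (j := j); rw [hx4]; field_simp
    obtain ⟨n, hn, hxn⟩ := hγall x hx0 hz
    obtain ⟨m, rfl⟩ : ∃ m, n = m + 1 := ⟨n - 1, by omega⟩
    refine ⟨m, (hs.inj ha hb hj ?_).symm⟩
    rw [hse m, ← hxn, hx4]; field_simp
  constructor
  · rcases (hs.nonneg 0).eq_or_lt with h0 | h0
    · rw [← h0]; norm_num
    · obtain ⟨n, hn⟩ := hsurj 0 h0
      have := he n
      rw [hn] at this
      rw [← this]
      have h1 : γ 1 ≤ γ (n + 1) := hsm.monotone (Nat.zero_le n)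
      have h2 : 0 < γ 1 := hp 0
      gcongr
  · intro k
    have : Function.support (fun j => s j ^ (k + 1)) ⊆ Set.range e := by
      intro j hj
      have : s j ≠ 0 := fun h => hj (by simp [h])
      exact hsurj j (lt_of_le_of_ne (hs.nonneg j) this.symm)
    rw [← hinj.tsum_eq this, ← tsum_mul_left]
    congr 1; ext n
    rw [hse, div_pow, ← pow_mul]; ring

theorem Wcal_log_deriv_series (ν : ℝ) (hν : -1 < ν) (γ : ℕ → ℝ)
    (hγpos : ∀ n, 1 ≤ n → 0 < γ n)
    (hγmono : ∀ m n, 1 ≤ m → m < n → γ m < γ n)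
    (hγzero : ∀ n, 1 ≤ n → Wcal ν (γ n) = 0)
    (hγall : ∀ x : ℝ, 0 < x → Wcal ν x = 0 → ∃ n, 1 ≤ n ∧ x = γ n)
    (hζsum : ∀ m : ℕ, 1 ≤ m → Summable (fun n : ℕ => 1 / γ (n + 1) ^ (4 * m))) :
    (∀ x : ℝ, |x| < γ 1 →
      HasSum (fun m : ℕ =>
          (-4 : ℝ) * (∑' n : ℕ, 1 / γ (n + 1) ^ (4 * (m + 1))) * x ^ (4 * (m + 1)))
        (x * deriv (Wcal ν) x / Wcal ν x)) ∧
    AbsolutelyMonotonicOn (fun x : ℝ => -(x * deriv (Wcal ν) x / Wcal ν x))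
      (Set.Ioo 0 (γ 1)) := by
  obtain ⟨s, hs⟩ := core_exists (a := ν + 1) (b := ν + 2) (by linarith) (by linarith)
  obtain ⟨h0, hz⟩ := zeta_match hν hγpos hγmono hγzero hγall hs
  have main : ∀ x : ℝ, |x| < γ 1 →
      HasSum (fun m : ℕ =>
          (-4 : ℝ) * (∑' n : ℕ, 1 / γ (n + 1) ^ (4 * (m + 1))) * x ^ (4 * (m + 1)))
        (x * deriv (Wcal ν) x / Wcal ν x) := by
    intro x hx
    have hx4 : x ^ 4 < γ 1 ^ 4 := by
      have : |x| ^ 4 < γ 1 ^ 4 := by gcongr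
      rwa [Even.pow_abs (by decide)] at this
    have hlt : s 0 * (x ^ 4 / 16) < 1 := by
      rcases (hs.nonneg 0).eq_or_lt with h | h
      · rw [← h]; norm_num
      · refine lt_of_lt_of_le ?_ h0
        gcongr
    have hexp := (hs.expansion (by linarith) (by linarith)
      (by positivity : (0:ℝ) ≤ x ^ 4 / 16) hlt).2.mul_left (-4)
    rw [Wcal_eq hν, Wcal_deriv hν]
    have e1 : ∀ m : ℕ, -4 * ((∑' j, s j ^ (m + 1)) * (x ^ 4 / 16) ^ (m + 1))
        = (-4 : ℝ) * (∑' n : ℕ, 1 / γ (n + 1) ^ (4 * (m + 1))) * x ^ (4 * (m + 1)) := by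
      intro m
      rw [hz m, div_pow, ← pow_mul]
      field_simp
    have e2 : -4 * -(EE (ν + 1) (ν + 2) 1 (x ^ 4 / 16) / EE (ν + 1) (ν + 2) 0 (x ^ 4 / 16))
        = 4 * EE (ν + 1) (ν + 2) 1 (x ^ 4 / 16) / EE (ν + 1) (ν + 2) 0 (x ^ 4 / 16) := by ring
    rw [e2] at hexp
    simpa only [e1] using hexp
  refine ⟨main, ?_⟩
  have hi : Function.Injective fun m : ℕ => 4 * (m + 1) := fun m n h => by
    simp only at h; omega
  set z : ℕ → ℝ := fun m => 4 * ∑' n : ℕ, 1 / γ (n + 1) ^ (4 * (m + 1)) with hzdef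
  have hz0 : ∀ m, 0 ≤ z m := fun m => mul_nonneg (by norm_num)
    (tsum_nonneg fun n => by have := hγpos (n + 1) (by omega); positivity)
  set c : ℕ → ℝ := Function.extend (fun m : ℕ => 4 * (m + 1)) z 0 with hc
  have hc0 : ∀ n, 0 ≤ c n := by
    intro n
    by_cases h : ∃ m : ℕ, 4 * (m + 1) = n
    · obtain ⟨m, rfl⟩ := h
      rw [hc, hi.extend_apply z 0 m]; exact hz0 m
    · rw [hc, Function.extend_apply' _ _ _ h]; simp
  have hsum : ∀ x ∈ Ioo 0 (γ 1), HasSum (fun n => c n * x ^ n)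
      ((fun x : ℝ => -(x * deriv (Wcal ν) x / Wcal ν x)) x) := by
    intro x hx
    have h1 := (main x (by rw [abs_of_pos hx.1]; exact hx.2)).neg
    rw [← hi.hasSum_iff]
    · have e1 : ∀ m : ℕ, ((fun n => c n * x ^ n) ∘ fun m : ℕ => 4 * (m + 1)) m
          = -((-4 : ℝ) * (∑' n : ℕ, 1 / γ (n + 1) ^ (4 * (m + 1))) * x ^ (4 * (m + 1))) := by
        intro m
        change c (4 * (m + 1)) * x ^ (4 * (m + 1)) = _
        rw [hc, hi.extend_apply z 0 m, hzdef]; ring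
      rw [funext e1]
      exact h1
    · intro n hn
      rw [hc, Function.extend_apply' _ _ _ (fun ⟨m, h⟩ => hn ⟨m, h⟩)]; simp
  exact ⟨contDiffOn_of_differentiableOn_deriv fun m _ => (ps_iter m hc0 hsum).1,
    fun k => (ps_iter k hc0 hsum).2⟩
end

section
/- Let ν > -1 and let γ_{ν,1} be the smallest positive zero of W_ν. Then for all x with 0 ≤ x < γ_{ν,1}: W_ν(x) ≤ x^{2ν+1}·e^{-x⁴/(16(ν+1)(ν+2)(ν+3))}/(2^{2ν}·Γ(ν+1)·Γ(ν+2)). -/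
open Real Set

/-- term of the entire function `E ν t = ∑ t^n / (n! Γ(ν+n+1))` -/
noncomputable def bTerm (ν t : ℝ) (n : ℕ) : ℝ :=
  t ^ n / ((n.factorial : ℝ) * Real.Gamma (ν + n + 1))

noncomputable def bE (ν t : ℝ) : ℝ := ∑' n : ℕ, bTerm ν t n

lemma gam_pos {ν : ℝ} (hν : -1 < ν) (n : ℕ) : 0 < Real.Gamma (ν + n + 1) := by
  apply Real.Gamma_pos_of_pos
  have : (0 : ℝ) ≤ n := Nat.cast_nonneg n
  linarith

lemma gam_lower {ν : ℝ} (hν : -1 < ν) (n : ℕ) :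
    (ν + 1) ^ n * Real.Gamma (ν + 1) ≤ Real.Gamma (ν + n + 1) := by
  induction n with
  | zero => simp
  | succ k ih =>
    have hk : (0 : ℝ) ≤ k := Nat.cast_nonneg k
    have h1 : Real.Gamma (ν + (k + 1 : ℕ) + 1) = (ν + k + 1) * Real.Gamma (ν + k + 1) := by
      rw [← Real.Gamma_add_one (by linarith)]
      push_cast
      congr 1
      ring
    rw [h1, pow_succ]
    have h2 := gam_pos hν k
    calc (ν + 1) ^ k * (ν + 1) * Real.Gamma (ν + 1)
        = (ν + 1) * ((ν + 1) ^ k * Real.Gamma (ν + 1)) := by ring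
      _ ≤ (ν + 1) * Real.Gamma (ν + k + 1) := mul_le_mul_of_nonneg_left ih (by linarith)
      _ ≤ _ := mul_le_mul_of_nonneg_right (by linarith) h2.le

lemma bTerm_summable {ν : ℝ} (hν : -1 < ν) (t : ℝ) : Summable (bTerm ν t) := by
  have h0 : 0 < ν + 1 := by linarith
  have hg : 0 < Real.Gamma (ν + 1) := Real.Gamma_pos_of_pos h0
  have hs := (Real.summable_pow_div_factorial (|t| / (ν + 1))).mul_right (1 / Real.Gamma (ν + 1))
  refine Summable.of_norm_bounded hs (fun n => ?_)
  have h1 := gam_lower hν n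
  have h2 := gam_pos hν n
  have hf : (0 : ℝ) < n.factorial := by exact_mod_cast n.factorial_pos
  have hp : 0 < (ν + 1) ^ n := pow_pos h0 n
  unfold bTerm
  rw [norm_div, norm_mul, norm_pow, Real.norm_eq_abs, Real.norm_of_nonneg hf.le,
    Real.norm_of_nonneg h2.le]
  have : (|t| / (ν + 1)) ^ n / (n.factorial : ℝ) * (1 / Real.Gamma (ν + 1))
      = |t| ^ n / (n.factorial * ((ν + 1) ^ n * Real.Gamma (ν + 1))) := by
    rw [div_pow]; field_simp
  rw [this]
  gcongr

lemma bTerm_succ {ν : ℝ} (hν : -1 < ν) (t : ℝ) (n : ℕ) :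
    ((n + 1 : ℕ) : ℝ) * t ^ n / (((n + 1).factorial : ℝ) * Real.Gamma (ν + (n + 1 : ℕ) + 1))
      = bTerm (ν + 1) t n := by
  have h2 := gam_pos (ν := ν + 1) (by linarith) n
  have hf : (0 : ℝ) < n.factorial := by exact_mod_cast n.factorial_pos
  have e : ν + ((n + 1 : ℕ) : ℝ) + 1 = ν + 1 + n + 1 := by push_cast; ring
  unfold bTerm
  rw [e, Nat.factorial_succ]
  push_cast
  have : (n : ℝ) + 1 ≠ 0 := by positivity
  field_simp

lemma bE_hasDerivAt {ν : ℝ} (hν : -1 < ν) (t : ℝ) : HasDerivAt (bE ν) (bE (ν + 1) t) t := by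
  set R : ℝ := |t| + 1 with hR
  have hR0 : 0 ≤ R := by positivity
  let g' : ℕ → ℝ → ℝ := fun n y =>
    (n : ℝ) * y ^ (n - 1) / ((n.factorial : ℝ) * Real.Gamma (ν + n + 1))
  have hu : Summable (fun n => g' n R) := by
    rw [← summable_nat_add_iff 1]
    refine (bTerm_summable (ν := ν + 1) (by linarith) R).congr (fun n => ?_)
    exact (bTerm_succ hν R n).symm
  have hsum : ∑' n, g' n t = bE (ν + 1) t := by
    have hs : Summable (fun n => g' n t) := by
      rw [← summable_nat_add_iff 1]
      refine (bTerm_summable (ν := ν + 1) (by linarith) t).congr (fun n => ?_)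
      exact (bTerm_succ hν t n).symm
    rw [hs.tsum_eq_zero_add]
    have h0 : g' 0 t = 0 := by simp [g']
    rw [h0, zero_add]
    exact tsum_congr (fun n => bTerm_succ hν t n)
  rw [← hsum]
  refine hasDerivAt_tsum_of_isPreconnected (g := fun n y => bTerm ν y n) hu
    (t := Metric.ball (0 : ℝ) R) Metric.isOpen_ball
    (convex_ball _ _).isPreconnected ?_ ?_ (y₀ := t) ?_ ?_ ?_
  · intro n y _
    exact (hasDerivAt_pow n y).div_const _
  · intro n y hy
    have hy' : |y| ≤ R := by
      have : |y| < R := by simpa using hy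
      exact this.le
    have hf : (0 : ℝ) < n.factorial := by exact_mod_cast n.factorial_pos
    have h2 := gam_pos hν n
    simp only [g']
    rw [norm_div, norm_mul, norm_mul, norm_pow, Real.norm_eq_abs y, Real.norm_of_nonneg hf.le,
      Real.norm_of_nonneg h2.le, Real.norm_of_nonneg (Nat.cast_nonneg n)]
    gcongr
  · simp [hR]
  · exact bTerm_summable hν t
  · simp [hR]

lemma bE_rec {ν : ℝ} (hν : -1 < ν) (t : ℝ) :
    t * bE (ν + 1 + 1) t = bE ν t - (ν + 1) * bE (ν + 1) t := by
  have hν1 : -1 < ν + 1 := by linarith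
  have s0 := bTerm_summable hν t
  have s1 := bTerm_summable hν1 t
  have s2 := bTerm_summable (ν := ν + 1 + 1) (by linarith) t
  have key : ∀ n : ℕ, bTerm ν t n - (ν + 1) * bTerm (ν + 1) t n = n * bTerm (ν + 1) t n := by
    intro n
    have hn : (0 : ℝ) ≤ n := Nat.cast_nonneg n
    have h2 := gam_pos hν n
    have hf : (0 : ℝ) < n.factorial := by exact_mod_cast n.factorial_pos
    have h3 : Real.Gamma (ν + 1 + n + 1) = (ν + n + 1) * Real.Gamma (ν + n + 1) := by
      rw [← Real.Gamma_add_one (by linarith)]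
      congr 1
      ring
    have h4 : ν + n + 1 ≠ 0 := by linarith
    unfold bTerm
    rw [h3]
    field_simp
    ring
  have hS : Summable (fun n => bTerm ν t n - (ν + 1) * bTerm (ν + 1) t n) :=
    s0.sub (s1.mul_left _)
  unfold bE
  rw [← tsum_mul_left, ← tsum_mul_left, ← s0.tsum_sub (s1.mul_left _), hS.tsum_eq_zero_add,
    key 0]
  simp only [Nat.cast_zero, zero_mul, zero_add]
  refine tsum_congr (fun n => ?_)
  rw [key, ← bTerm_succ hν1 t n]
  unfold bTerm
  rw [pow_succ]
  ring

/-- comparison lemma for `s g' + a g = f`. -/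
lemma hardy_lower {a m y : ℝ} (k : ℕ) (ha : 0 < a) (hy : 0 < y) {g g' : ℝ → ℝ}
    (hg : ∀ s, HasDerivAt g (g' s) s)
    (hf : ∀ s, 0 < s → s < y → m * s ^ k ≤ s * g' s + a * g s) :
    m * y ^ k / (a + k) ≤ g y := by
  have hak : a + k ≠ 0 := by positivity
  let h : ℝ → ℝ := fun s => s ^ a * (g s - m * s ^ k / (a + k))
  have hcont : ContinuousOn h (Icc 0 y) := by
    have hgc : Continuous g := continuous_iff_continuousAt.2 fun s => (hg s).continuousAt
    have h1 : Continuous (fun s : ℝ => s ^ a) := Real.continuous_rpow_const ha.le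
    exact (h1.mul (by fun_prop)).continuousOn
  have hder : ∀ s, 0 < s → HasDerivAt h
      (a * s ^ (a - 1) * (g s - m * s ^ k / (a + k))
        + s ^ a * (g' s - m * (k * s ^ (k - 1)) / (a + k))) s := by
    intro s hs
    have h1 := Real.hasDerivAt_rpow_const (x := s) (p := a) (Or.inl hs.ne')
    have h2 := ((hasDerivAt_pow k s).const_mul m).div_const (a + k)
    exact h1.mul ((hg s).sub h2)
  have hmono : MonotoneOn h (Icc 0 y) := by
    apply monotoneOn_of_deriv_nonneg (convex_Icc 0 y) hcont
    · intro s hs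
      rw [interior_Icc] at hs
      exact (hder s hs.1).differentiableAt.differentiableWithinAt
    · intro s hs
      rw [interior_Icc] at hs
      rw [(hder s hs.1).deriv]
      have hs0 := hs.1
      have e1 : s ^ a = s ^ (a - 1) * s := by
        rw [Real.rpow_sub_one hs0.ne']; field_simp
      have e2 : (k : ℝ) * s ^ (k - 1) * s = k * s ^ k := by
        cases k with
        | zero => simp
        | succ j => simp [pow_succ]; ring
      have e3 : a * s ^ (a - 1) * (g s - m * s ^ k / (a + k))
        + s ^ a * (g' s - m * (k * s ^ (k - 1)) / (a + k))
        = s ^ (a - 1) * (s * g' s + a * g s - m * s ^ k) := by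
        have e4 : m * s ^ k = (a * (m * s ^ k) + m * (k * s ^ (k - 1) * s)) / (a + k) := by
          rw [e2]; field_simp
        rw [e1]
        conv_rhs => rw [e4]
        ring
      rw [e3]
      have := hf s hs.1 hs.2
      exact mul_nonneg (Real.rpow_nonneg hs0.le _) (by linarith)
  have := hmono (left_mem_Icc.2 hy.le) (right_mem_Icc.2 hy.le) hy.le
  simp only [h] at this
  rw [Real.zero_rpow ha.ne', zero_mul] at this
  have hp : 0 < y ^ a := Real.rpow_pos_of_pos hy a
  have := nonneg_of_mul_nonneg_right this hp
  linarith

noncomputable def wF (ν y : ℝ) : ℝ :=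
  bE (ν + 1) (-y) * bE ν y + bE ν (-y) * bE (ν + 1) y

lemma bE_neg_hasDerivAt {ν : ℝ} (hν : -1 < ν) (t : ℝ) :
    HasDerivAt (fun y => bE ν (-y)) (-bE (ν + 1) (-t)) t := by
  have := (bE_hasDerivAt hν (-t)).comp t (hasDerivAt_neg t)
  rw [mul_neg, mul_one] at this
  exact this

lemma wF_main {ν : ℝ} (hν : -1 < ν) {Y : ℝ} (hY : 0 < Y)
    (hpos : ∀ y, 0 < y → y < Y → 0 < wF ν y) :
    ∀ y, 0 ≤ y → y < Y →
      wF ν y ≤ wF ν 0 * Real.exp (-(y ^ 2 / ((ν + 1) * (ν + 2) * (ν + 3)))) := by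
  have hν1 : -1 < ν + 1 := by linarith
  have a0 : 0 < ν + 1 := by linarith
  have hi0 := bE_hasDerivAt hν
  have hi1 := bE_hasDerivAt hν1
  have hj0 := bE_neg_hasDerivAt hν
  have hj1 := bE_neg_hasDerivAt hν1
  have ri := bE_rec hν
  have rj : ∀ t, t * bE (ν + 1 + 1) (-t) = -(bE ν (-t) - (ν + 1) * bE (ν + 1) (-t)) := by
    intro t
    have := bE_rec hν (-t)
    linarith
  generalize hj2e : (fun t => bE (ν + 1 + 1) (-t)) = j2 at *
  have hj2 : ∀ t, bE (ν + 1 + 1) (-t) = j2 t := fun t => by rw [← hj2e]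
  simp only [hj2] at hj1 rj
  let Q : ℝ → ℝ := fun y => bE (ν + 1) (-y) * bE (ν + 1) y
  let V : ℝ → ℝ := fun y => bE (ν + 1) (-y) * bE ν y - bE ν (-y) * bE (ν + 1) y
  let M : ℝ → ℝ := fun y => (ν + 1) * wF ν y - 2 * (bE ν (-y) * bE ν y)
  have hw : ∀ y, HasDerivAt (wF ν) _ y := fun y =>
    ((hj1 y).mul (hi0 y)).add ((hj0 y).mul (hi1 y))
  have hQ : ∀ y, HasDerivAt Q _ y := fun y => (hj1 y).mul (hi1 y)
  have hV : ∀ y, HasDerivAt V _ y := fun y =>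
    ((hj1 y).mul (hi0 y)).sub ((hj0 y).mul (hi1 y))
  have hM : ∀ y, HasDerivAt M _ y := fun y =>
    ((hw y).const_mul (ν + 1)).sub (((hj0 y).mul (hi0 y)).const_mul 2)
  have ew : ∀ y, y * deriv (wF ν) y = - M y := by
    intro y
    rw [(hw y).deriv]
    simp only [M, wF]
    linear_combination (bE ν y) * (-rj y) + bE ν (-y) * ri y
  have hw' : ∀ y, HasDerivAt (wF ν) (deriv (wF ν) y) y := fun y =>
    (hw y).differentiableAt.hasDerivAt
  have hQ' : ∀ y, HasDerivAt Q (deriv Q y) y := fun y => (hQ y).differentiableAt.hasDerivAt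
  have hV' : ∀ y, HasDerivAt V (deriv V y) y := fun y => (hV y).differentiableAt.hasDerivAt
  have hM' : ∀ y, HasDerivAt M (deriv M y) y := fun y => (hM y).differentiableAt.hasDerivAt
  have eQ : ∀ y, y * deriv Q y + 2 * (ν + 1) * Q y = wF ν y := by
    intro y
    rw [(hQ y).deriv]
    simp only [Q, wF]
    linear_combination (bE (ν + 1) y) * (-rj y) + bE (ν + 1) (-y) * ri y
  have eV : ∀ y, y * deriv V y + (ν + 1) * V y = 2 * y * Q y := by
    intro y
    rw [(hV y).deriv]
    simp only [Q, V]
    linear_combination (bE ν y) * (-rj y) - bE ν (-y) * ri y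
  have eM : ∀ y, y * deriv M y + (ν + 1) * M y = 2 * y * V y := by
    intro y
    have h1 := ew y
    rw [(hw y).deriv] at h1
    rw [(hM y).deriv]
    simp only [V]
    linear_combination (ν + 1) * h1
  -- the chain
  have chain : ∀ m y, 0 < y → (∀ s, 0 < s → s < y → m ≤ wF ν s) →
      2 * m * y ^ 2 / ((ν + 1) * (ν + 2) * (ν + 3)) ≤ M y := by
    intro m y hy hm
    have q1 : ∀ s, 0 < s → s < y → m / (2 * (ν + 1)) ≤ Q s := by
      intro s hs hsy
      have := hardy_lower (a := 2 * (ν + 1)) (m := m) 0 (by linarith) hs hQ' (by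
        intro r hr hrs
        rw [eQ]
        simpa using hm r hr (hrs.trans hsy))
      simpa using this
    have v1 : ∀ s, 0 < s → s < y → m / (ν + 1) * s / (ν + 2) ≤ V s := by
      intro s hs hsy
      have := hardy_lower (a := ν + 1) (m := m / (ν + 1)) 1 a0 hs hV' (by
        intro r hr hrs
        rw [eV]
        have h1 := mul_le_mul_of_nonneg_left (q1 r hr (hrs.trans hsy)) (by linarith : 0 ≤ 2 * r)
        refine le_trans (le_of_eq ?_) h1
        field_simp)
      convert this using 2
      · ring
      · push_cast; ring
    have := hardy_lower (a := ν + 1) (m := 2 * m / ((ν + 1) * (ν + 2))) 2 a0 hy hM' (by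
        intro r hr hrs
        rw [eM]
        have h1 := mul_le_mul_of_nonneg_left (v1 r hr hrs) (by linarith : 0 ≤ 2 * r)
        refine le_trans (le_of_eq ?_) h1
        have : ν + 2 ≠ 0 := by linarith
        field_simp)
    refine le_trans (le_of_eq ?_) this
    have : ν + 2 ≠ 0 := by linarith
    have : ν + 3 ≠ 0 := by linarith
    have e : ν + 1 + ((2 : ℕ) : ℝ) = ν + 3 := by push_cast; ring
    rw [e]
    field_simp
  have hwc : Continuous (wF ν) := continuous_iff_continuousAt.2 fun s => (hw s).continuousAt
  have hanti : AntitoneOn (wF ν) (Ico 0 Y) := by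
    apply antitoneOn_of_deriv_nonpos (convex_Ico 0 Y) hwc.continuousOn
    · intro s _
      exact (hw s).differentiableAt.differentiableWithinAt
    · intro s hs
      rw [interior_Ico] at hs
      have h1 := chain 0 s hs.1 (fun r hr hrs => (hpos r hr (hrs.trans hs.2)).le)
      have h2 := ew s
      simp only [mul_zero, zero_mul, zero_div] at h1
      by_contra hc
      push Not at hc
      have := mul_pos hs.1 hc
      linarith
  set c := (ν + 1) * (ν + 2) * (ν + 3) with hc
  have hc0 : 0 < c := by
    have : 0 < ν + 2 := by linarith
    have : 0 < ν + 3 := by linarith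
    positivity
  let F : ℝ → ℝ := fun y => wF ν y * Real.exp (y ^ 2 / c)
  have hF : ∀ y, HasDerivAt F (deriv (wF ν) y * Real.exp (y ^ 2 / c)
      + wF ν y * (Real.exp (y ^ 2 / c) * (2 * y / c))) y := by
    intro y
    have h1 := ((hasDerivAt_pow 2 y).div_const c).exp
    have := (hw' y).mul h1
    refine this.congr_deriv ?_
    norm_num
  have hFc : Continuous F := continuous_iff_continuousAt.2 fun s => (hF s).continuousAt
  have hFanti : AntitoneOn F (Ico 0 Y) := by
    apply antitoneOn_of_deriv_nonpos (convex_Ico 0 Y) hFc.continuousOn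
    · intro s _
      exact (hF s).differentiableAt.differentiableWithinAt
    · intro s hs
      rw [interior_Ico] at hs
      rw [(hF s).deriv]
      have h1 := chain (wF ν s) s hs.1 (fun r hr hrs =>
        hanti ⟨hr.le, hrs.trans hs.2⟩ ⟨hs.1.le, hs.2⟩ hrs.le)
      have h2 := ew s
      have h3 : deriv (wF ν) s + wF ν s * (2 * s / c) ≤ 0 := by
        by_contra hcon
        push Not at hcon
        have h4 := mul_pos hs.1 hcon
        have h5 : s * (deriv (wF ν) s + wF ν s * (2 * s / c))
          = s * deriv (wF ν) s + 2 * wF ν s * s ^ 2 / c := by ring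
        linarith
      have h6 := mul_nonneg (neg_nonneg.2 h3) (Real.exp_pos (s ^ 2 / c)).le
      nlinarith [h6]
  intro y hy0 hyY
  have := hFanti ⟨le_refl 0, hY⟩ ⟨hy0, hyY⟩ hy0
  simp only [F] at this
  norm_num at this
  rw [Real.exp_neg, ← div_eq_mul_inv, le_div_iff₀ (Real.exp_pos _)]
  exact this

lemma bE_zero (ν : ℝ) : bE ν 0 = 1 / Real.Gamma (ν + 1) := by
  unfold bE
  rw [tsum_eq_single 0]
  · simp [bTerm]
  · intro n hn
    simp [bTerm, hn]

lemma besselI_eq {ν x : ℝ} (hx : 0 < x) : besselI ν x = (x / 2) ^ ν * bE ν (x ^ 2 / 4) := by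
  unfold besselI bE
  rw [← tsum_mul_left]
  refine tsum_congr (fun n => ?_)
  unfold bTerm
  rw [Real.rpow_add (by positivity), show (2 * (n : ℝ)) = ((2 * n : ℕ) : ℝ) by push_cast; ring,
    Real.rpow_natCast, pow_mul, show (x / 2) ^ 2 = x ^ 2 / 4 by ring, mul_div_assoc]

lemma besselJ_eq {ν x : ℝ} (hx : 0 < x) : besselJ ν x = (x / 2) ^ ν * bE ν (-(x ^ 2 / 4)) := by
  unfold besselJ bE
  rw [← tsum_mul_left]
  refine tsum_congr (fun n => ?_)
  unfold bTerm
  rw [Real.rpow_add (by positivity), show (2 * (n : ℝ)) = ((2 * n : ℕ) : ℝ) by push_cast; ring,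
    Real.rpow_natCast, pow_mul, show (x / 2) ^ 2 = x ^ 2 / 4 by ring, neg_pow (x ^ 2 / 4)]
  ring

lemma crossW_eq {ν x : ℝ} (hx : 0 < x) :
    crossW ν x = (x / 2) ^ (2 * ν + 1) * wF ν (x ^ 2 / 4) := by
  have h : 0 < x / 2 := by positivity
  unfold crossW wF
  rw [besselI_eq hx, besselI_eq hx, besselJ_eq hx, besselJ_eq hx,
    show (x / 2) ^ (2 * ν + 1) = (x / 2) ^ ν * (x / 2) ^ (ν + 1) by
      rw [← Real.rpow_add h]; congr 1; ring]
  generalize (x / 2) ^ (ν + 1) = A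
  ring

lemma crossW_zero {ν : ℝ} (hν : -1 < ν) : crossW ν 0 = 0 := by
  have h : ∀ n : ℕ, ((0 : ℝ) / 2) ^ (ν + 1 + 2 * (n : ℝ)) = 0 := by
    intro n
    have hn : (0 : ℝ) ≤ n := Nat.cast_nonneg n
    rw [zero_div, Real.zero_rpow (by linarith)]
  unfold crossW besselI besselJ
  simp only [h]
  simp

/-- Upper bound for the cross-product of Bessel and modified Bessel functions. -/
theorem crossW_upper_bound (ν : ℝ) (hν : -1 < ν) (γ1 : ℝ)
    (hγ1pos : 0 < γ1) (hγ1zero : crossW ν γ1 = 0)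
    (hγ1min : ∀ x : ℝ, 0 < x → crossW ν x = 0 → γ1 ≤ x) :
    ∀ x : ℝ, 0 ≤ x → x < γ1 →
      crossW ν x ≤ x ^ (2 * ν + 1) *
        Real.exp (-x ^ 4 / (16 * ((ν + 1) * (ν + 2) * (ν + 3)))) /
          ((2 : ℝ) ^ (2 * ν) * Real.Gamma (ν + 1) * Real.Gamma (ν + 2)) := by
  intro x hx0 hxγ
  have a0 : 0 < ν + 1 := by linarith
  have hG1 : 0 < Real.Gamma (ν + 1) := Real.Gamma_pos_of_pos a0
  have hG2 : 0 < Real.Gamma (ν + 2) := Real.Gamma_pos_of_pos (by linarith)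
  rcases hx0.eq_or_lt with h | hx
  · subst h
    rw [crossW_zero hν]
    positivity
  have hw0 : wF ν 0 = 2 / (Real.Gamma (ν + 1) * Real.Gamma (ν + 2)) := by
    unfold wF
    rw [neg_zero, bE_zero, bE_zero, show ν + 1 + 1 = ν + 2 by ring]
    field_simp
    ring
  have hwc : Continuous (wF ν) := by
    have hν1 : -1 < ν + 1 := by linarith
    exact continuous_iff_continuousAt.2 fun y =>
      (((bE_neg_hasDerivAt hν1 y).mul (bE_hasDerivAt hν y)).add
        ((bE_neg_hasDerivAt hν y).mul (bE_hasDerivAt hν1 y))).continuousAt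
  have hpos : ∀ y, 0 < y → y < γ1 ^ 2 / 4 → 0 < wF ν y := by
    intro y hy hyY
    by_contra hc
    push Not at hc
    have h0 : 0 ≤ wF ν 0 := by rw [hw0]; positivity
    obtain ⟨s, hs, hs0⟩ := intermediate_value_Icc' hy.le hwc.continuousOn
      (show (0 : ℝ) ∈ Icc (wF ν y) (wF ν 0) from ⟨hc, h0⟩)
    have hspos : 0 < s := by
      rcases hs.1.eq_or_lt with h | h
      · exfalso
        rw [← h, hw0] at hs0
        have : 0 < 2 / (Real.Gamma (ν + 1) * Real.Gamma (ν + 2)) := by positivity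
        linarith
      · exact h
    have hr : 0 < 2 * Real.sqrt s := by positivity
    have h1 := hγ1min (2 * Real.sqrt s) hr (by
      rw [crossW_eq hr, show (2 * Real.sqrt s) ^ 2 / 4 = s by
        rw [mul_pow, Real.sq_sqrt hspos.le]; ring, hs0, mul_zero])
    have h2 : γ1 ^ 2 ≤ (2 * Real.sqrt s) ^ 2 := pow_le_pow_left₀ hγ1pos.le h1 2
    rw [mul_pow, Real.sq_sqrt hspos.le] at h2
    linarith [hs.2]
  have hlt : x ^ 2 / 4 < γ1 ^ 2 / 4 := by
    have := pow_lt_pow_left₀ hxγ hx0 (two_ne_zero)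
    linarith
  have key := wF_main hν (by positivity) hpos (x ^ 2 / 4) (by positivity) hlt
  rw [crossW_eq hx]
  refine (mul_le_mul_of_nonneg_left key (by positivity)).trans (le_of_eq ?_)
  have e1 : -((x ^ 2 / 4) ^ 2 / ((ν + 1) * (ν + 2) * (ν + 3)))
      = -x ^ 4 / (16 * ((ν + 1) * (ν + 2) * (ν + 3))) := by
    have : ν + 2 ≠ 0 := by linarith
    have : ν + 3 ≠ 0 := by linarith
    field_simp
    ring
  have e2 : (2 : ℝ) ^ (2 * ν + 1) = 2 ^ (2 * ν) * 2 := by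
    rw [Real.rpow_add two_pos, Real.rpow_one]
  rw [e1, hw0, Real.div_rpow hx0 two_pos.le, e2]
  have : (0 : ℝ) < 2 ^ (2 * ν) := by positivity
  field_simp
end
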